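/- Let f ∈ W¹₁(ℝⁿ) with n ≥ 3. Then Σ_{k ∈ ℤ} 2^{k(2−n)} sup_{2^k ≤ r ≤ 2^{k+1}} ∫_{S_r} |f̂(ξ)| dσ(ξ) ≤ c ‖∇f‖₁, where S_r is the sphere of radius r centered at the origin in ℝⁿ and dσ its surface measure. -/

import Mathlib

open MeasureTheory ENNReal Set Real FourierTransform
noncomputable section

/-- g is the weak partial derivative of f in the k-th coordinate direction on ℝⁿ. -/
def IsWeakDerivE {n : ℕ} (k : Fin n) (f g : EuclideanSpace ℝ (Fin n) → ℝ) : Prop :=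
  ∀ φ : EuclideanSpace ℝ (Fin n) → ℝ, ContDiff ℝ (⊤ : ℕ∞) φ → HasCompactSupport φ →
    ∫ x, f x * deriv (fun s : ℝ => φ (x + s • EuclideanSpace.single k (1:ℝ))) 0
      = - ∫ x, g x * φ x

/-- The integral of |f̂| over the sphere of radius r (with its canonical surface
measure), written via the surface measure of the unit sphere. -/
def sphereFourierInt (n : ℕ) (f : EuclideanSpace ℝ (Fin n) → ℝ) (r : ℝ) : ℝ≥0∞ :=
  ENNReal.ofReal (r ^ (n-1)) *
    ∫⁻ θ : Metric.sphere (0 : EuclideanSpace ℝ (Fin n)) 1,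
      (‖𝓕 (fun x => (f x : ℂ)) (r • (θ : EuclideanSpace ℝ (Fin n)))‖₊ : ℝ≥0∞)
      ∂((volume : Measure (EuclideanSpace ℝ (Fin n))).toSphere)

set_option linter.unusedSectionVars false
open Module Metric
open scoped RealInnerProductSpace ComplexConjugate Pointwise

section Duality

variable {V : Type*} [NormedAddCommGroup V] [InnerProductSpace ℝ V] [FiniteDimensional ℝ V]
  [MeasurableSpace V] [BorelSpace V]

/-- The Fourier transform `z ↦ ∫ e^{-2πi⟪x, z⟫} f x ∂μ` of the density `f` against `μ`. -/
def fourierWith (μ : Measure V) (f : V → ℂ) (z : V) : ℂ :=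
  ∫ x, 𝐞 (-⟪x, z⟫) • f x ∂μ

lemma fourierWith_eq (μ : Measure V) (f : V → ℂ) :
    fourierWith μ f = VectorFourier.fourierIntegral 𝐞 μ (innerₗ V) f := rfl

lemma fourierWith_volume (f : V → ℂ) : fourierWith volume f = 𝓕 f := rfl

lemma norm_fourierWith_le (μ : Measure V) (f : V → ℂ) (z : V) :
    ‖fourierWith μ f z‖ ≤ ∫ x, ‖f x‖ ∂μ := by
  rw [fourierWith_eq]
  exact VectorFourier.norm_fourierIntegral_le_integral_norm _ _ _ _ _

lemma continuous_innerₗ_uncurried : Continuous fun p : V × V ↦ innerₗ V p.1 p.2 :=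
  continuous_inner

lemma continuous_fourierWith {μ : Measure V} {f : V → ℂ} (hf : Integrable f μ) :
    Continuous (fourierWith μ f) :=
  VectorFourier.fourierIntegral_continuous Real.continuous_fourierChar
    continuous_innerₗ_uncurried hf

lemma conj_fourierWith (μ : Measure V) (f : V → ℂ) (z : V) :
    conj (fourierWith μ f z) = ∫ x, 𝐞 ⟪x, z⟫ • conj (f x) ∂μ := by
  rw [fourierWith, ← integral_conj]
  congr 1 with x
  simp [Circle.smul_def, AddChar.map_neg_eq_inv]

/-- The inner integral in the `T T*` identity. -/
lemma fourierWith_conj_mul {μ ν : Measure V} [SigmaFinite μ] [SigmaFinite ν] {f g : V → ℂ}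
    (hf : Integrable f μ) (hg : Integrable g ν) (x : V) :
    fourierWith ν (fun ξ ↦ conj (fourierWith μ f ξ) * g ξ) x
      = ∫ y, conj (f y) * fourierWith ν g (x - y) ∂μ := by
  have hint : Integrable (Function.uncurry fun ξ y : V ↦
      (𝐞 (-⟪ξ, x⟫) : ℂ) * ((𝐞 ⟪y, ξ⟫ : ℂ) * conj (f y) * g ξ)) (ν.prod μ) := by
    have h0 : Integrable (fun p : V × V ↦ g p.1 * conj (f p.2)) (ν.prod μ) :=
      hg.mul_prod ((RCLike.conjLIE (K := ℂ)).toContinuousLinearEquiv.integrable_comp_iff.2 hf)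
    have h1 : Continuous fun p : V × V ↦ (𝐞 (-⟪p.1, x⟫) : ℂ) * (𝐞 ⟪p.2, p.1⟫ : ℂ) := by
      have := Real.continuous_fourierChar
      fun_prop
    refine (h0.bdd_mul (c := 1) h1.aestronglyMeasurable (ae_of_all _ fun p ↦ ?_)).congr
      (ae_of_all _ fun p ↦ ?_)
    · rw [norm_mul, Circle.norm_coe, Circle.norm_coe, mul_one]
    · simp only [Function.uncurry]; ring
  calc fourierWith ν (fun ξ ↦ conj (fourierWith μ f ξ) * g ξ) x
      = ∫ ξ, ∫ y, (𝐞 (-⟪ξ, x⟫) : ℂ) * ((𝐞 ⟪y, ξ⟫ : ℂ) * conj (f y) * g ξ) ∂μ ∂ν := by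
        rw [fourierWith]
        congr 1 with ξ
        rw [conj_fourierWith, Circle.smul_def, smul_eq_mul, ← integral_mul_const,
          ← integral_const_mul]
        simp [Circle.smul_def]
    _ = ∫ y, ∫ ξ, (𝐞 (-⟪ξ, x⟫) : ℂ) * ((𝐞 ⟪y, ξ⟫ : ℂ) * conj (f y) * g ξ) ∂ν ∂μ :=
        integral_integral_swap hint
    _ = _ := by
        congr 1 with y
        rw [fourierWith, ← integral_const_mul]
        congr 1 with ξ
        have : -⟪ξ, x - y⟫ = -⟪ξ, x⟫ + ⟪y, ξ⟫ := by
          rw [inner_sub_right, real_inner_comm y ξ]; ring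
        rw [this, AddChar.map_add_eq_mul, Circle.smul_def]
        push_cast
        simp only [smul_eq_mul]
        ring

/-- The `T T*` bound for the Fourier transform. -/
lemma integral_norm_fourierWith_sq_le {μ ν : Measure V} [SigmaFinite μ] [SigmaFinite ν]
    {f : V → ℂ} {w : V → ℝ} (hf : Integrable f μ) (hw : Integrable w ν) {M : ℝ}
    (hM : ∀ x, ∫ y, ‖f y‖ * ‖fourierWith ν (fun ξ ↦ (w ξ : ℂ)) (x - y)‖ ∂μ ≤ M) :
    ∫ ξ, w ξ * ‖fourierWith μ f ξ‖ ^ 2 ∂ν ≤ M * ∫ x, ‖f x‖ ∂μ := by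
  set g : V → ℂ := fun ξ ↦ (w ξ : ℂ)
  have hg : Integrable g ν := hw.ofReal
  have hFg : Integrable (fun ξ ↦ conj (fourierWith μ f ξ) * g ξ) ν :=
    hg.bdd_mul (c := ∫ x, ‖f x‖ ∂μ)
      (Complex.continuous_conj.comp (continuous_fourierWith hf)).aestronglyMeasurable
      (ae_of_all _ fun ξ ↦ by simpa using norm_fourierWith_le μ f ξ)
  have key : ((∫ ξ, w ξ * ‖fourierWith μ f ξ‖ ^ 2 ∂ν : ℝ) : ℂ)
      = ∫ x, f x * ∫ y, conj (f y) * fourierWith ν g (x - y) ∂μ ∂μ := by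
    have h := VectorFourier.integral_fourierIntegral_smul_eq_flip (e := 𝐞) (μ := μ) (ν := ν)
      (L := innerₗ V) Real.continuous_fourierChar continuous_innerₗ_uncurried hf hFg
    rw [flip_innerₗ, ← fourierWith_eq, ← fourierWith_eq] at h
    simp only [smul_eq_mul, fourierWith_conj_mul hf hg] at h
    rw [← h, ← integral_complex_ofReal]
    congr 1 with ξ
    rw [← mul_assoc, RCLike.mul_conj]
    simp [g, mul_comm]
  have h1 : ∫ ξ, w ξ * ‖fourierWith μ f ξ‖ ^ 2 ∂ν ≤
      ‖∫ x, f x * ∫ y, conj (f y) * fourierWith ν g (x - y) ∂μ ∂μ‖ := by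
    rw [← key, Complex.norm_real]
    exact le_abs_self _
  refine h1.trans ?_
  rw [mul_comm, ← integral_mul_const]
  refine norm_integral_le_of_norm_le (hf.norm.mul_const M) (ae_of_all _ fun x ↦ ?_)
  rw [norm_mul]
  gcongr
  refine (norm_integral_le_integral_norm _).trans (le_trans (le_of_eq ?_) (hM x))
  simp [g]

end Duality

section SphereMeasure

variable {V : Type*} [NormedAddCommGroup V] [InnerProductSpace ℝ V] [FiniteDimensional ℝ V]
  [MeasurableSpace V] [BorelSpace V]

variable (V) in
/-- The surface measure of the unit sphere, as a measure on the ambient space. -/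
def sphereMeasure : Measure V :=
  (volume : Measure V).toSphere.map Subtype.val

instance : IsFiniteMeasure (sphereMeasure V) := by
  unfold sphereMeasure; infer_instance

lemma ae_sphereMeasure_norm : ∀ᵐ x ∂(sphereMeasure V), ‖x‖ = 1 := by
  rw [sphereMeasure, ae_map_iff measurable_subtype_coe.aemeasurable
    (measurableSet_eq_fun measurable_norm measurable_const)]
  exact ae_of_all _ fun θ ↦ by simp

lemma map_sphereMeasure (U : V ≃ₗᵢ[ℝ] V) : (sphereMeasure V).map U = sphereMeasure V := by
  ext A hA
  have hU : Measurable U := U.continuous.measurable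
  have hval : Measurable (Subtype.val : sphere (0 : V) 1 → V) := measurable_subtype_coe
  rw [Measure.map_apply hU hA, sphereMeasure, Measure.map_apply hval (hU hA),
    Measure.map_apply hval hA, Measure.toSphere_apply' _ (hval (hU hA)),
    Measure.toSphere_apply' _ (hval hA)]
  congr 1
  rw [← U.measurePreserving.measure_preimage_emb U.toHomeomorph.measurableEmbedding
    (Ioo (0 : ℝ) 1 • (Subtype.val '' (Subtype.val ⁻¹' A : Set (sphere (0 : V) 1))))]
  congr 1
  ext x
  simp only [mem_smul, mem_image, mem_preimage, Subtype.exists, mem_sphere_zero_iff_norm,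
    exists_and_left, exists_prop, exists_eq_right_right]
  constructor
  · rintro ⟨t, ht, y, ⟨hy, hy1⟩, rfl⟩
    exact ⟨t, ht, U y, ⟨hy, by simpa using hy1⟩, by simp⟩
  · rintro ⟨t, ht, y, ⟨hy, hy1⟩, hx⟩
    refine ⟨t, ht, U.symm y, ⟨by simpa using hy, by simpa using hy1⟩, ?_⟩
    rw [← map_smul, hx]; simp

lemma volumeIoiPow_Icc_ge (m : ℕ) (L : ℝ) :
    ENNReal.ofReal L ≤ Measure.volumeIoiPow m {r | r.1 ∈ Icc (1 : ℝ) (1 + L)} := by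
  have hms : MeasurableSet {r : Ioi (0 : ℝ) | r.1 ∈ Icc (1 : ℝ) (1 + L)} :=
    measurable_subtype_coe measurableSet_Icc
  rw [Measure.volumeIoiPow, withDensity_apply _ hms]
  calc ENNReal.ofReal L = volume (Icc (1 : ℝ) (1 + L)) := by simp
    _ = (Measure.comap Subtype.val volume) {r : Ioi (0 : ℝ) | r.1 ∈ Icc (1 : ℝ) (1 + L)} := by
        rw [comap_subtype_coe_apply measurableSet_Ioi]
        congr 1
        ext x
        simp only [mem_image, Subtype.exists, mem_Ioi, mem_ofPred_eq, exists_and_left,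
          exists_prop, exists_eq_right_right]
        exact ⟨fun h ↦ ⟨h, by linarith [h.1]⟩, fun h ↦ h.1⟩
    _ = ∫⁻ r in {r : Ioi (0 : ℝ) | r.1 ∈ Icc (1 : ℝ) (1 + L)}, 1
          ∂(Measure.comap Subtype.val volume) := by
        simp
    _ ≤ _ := by
        refine setLIntegral_mono' hms fun r hr ↦ ?_
        rw [← ENNReal.ofReal_one]
        exact ENNReal.ofReal_le_ofReal (one_le_pow₀ hr.1)

/-- Comparison of a surface integral with a volume integral over a thin shell. -/
lemma lintegral_sphereMeasure_le_of_shell {G h : V → ℝ≥0∞} (hG : Measurable G)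
    (hh : Measurable h) {L : ℝ}
    (hGh : ∀ θ : V, ‖θ‖ = 1 → ∀ r ∈ Icc 1 (1 + L), h θ ≤ G (r • θ)) :
    ENNReal.ofReal L * ∫⁻ θ, h θ ∂(sphereMeasure V) ≤ ∫⁻ x, G x := by
  have hval : Measurable (Subtype.val : sphere (0 : V) 1 → V) := measurable_subtype_coe
  set m := finrank ℝ V - 1
  set I : Set (Ioi (0 : ℝ)) := {r | r.1 ∈ Icc (1 : ℝ) (1 + L)}
  have hI : MeasurableSet I := measurable_subtype_coe measurableSet_Icc
  have hprod : Measurable fun p : sphere (0 : V) 1 × Ioi (0 : ℝ) ↦ G (p.2.1 • p.1.1) :=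
    hG.comp ((measurable_subtype_coe.comp measurable_snd).smul (hval.comp measurable_fst))
  calc ENNReal.ofReal L * ∫⁻ θ, h θ ∂(sphereMeasure V)
      = ∫⁻ θ : sphere (0 : V) 1, ENNReal.ofReal L * h θ ∂(volume : Measure V).toSphere := by
        rw [sphereMeasure, lintegral_map hh hval]
        exact (lintegral_const_mul _ (hh.comp hval)).symm
    _ ≤ ∫⁻ θ : sphere (0 : V) 1, ∫⁻ r : Ioi (0 : ℝ), G (r.1 • θ.1) ∂(Measure.volumeIoiPow m)
          ∂(volume : Measure V).toSphere := by
        refine lintegral_mono fun θ ↦ ?_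
        calc ENNReal.ofReal L * h θ ≤ h θ * Measure.volumeIoiPow m I := by
              rw [mul_comm]; gcongr; exact volumeIoiPow_Icc_ge m L
          _ = ∫⁻ r in I, h θ ∂(Measure.volumeIoiPow m) := by simp
          _ ≤ ∫⁻ r in I, G (r.1 • θ.1) ∂(Measure.volumeIoiPow m) :=
              setLIntegral_mono' hI fun r hr ↦ hGh θ (by simp) r hr
          _ ≤ _ := setLIntegral_le_lintegral _ _
    _ = ∫⁻ p, G (p.2.1 • p.1.1)
          ∂((volume : Measure V).toSphere.prod (Measure.volumeIoiPow m)) :=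
        (lintegral_prod _ hprod.aemeasurable).symm
    _ = ∫⁻ x : ({0}ᶜ : Set V), G x ∂(Measure.comap Subtype.val volume) := by
        rw [← (Measure.measurePreserving_homeomorphUnitSphereProd
          (volume : Measure V)).lintegral_comp hprod]
        congr 1 with x
        have : ‖x.1‖ ≠ 0 := norm_ne_zero_iff.2 x.2
        simp [smul_smul, this]
    _ ≤ ∫⁻ x, G x := by
        rw [lintegral_subtype_comap (measurableSet_singleton _).compl]
        exact setLIntegral_le_lintegral _ _

/-- The Fourier transform of the surface measure of the unit sphere. -/
def sphereKernel (z : V) : ℂ := fourierWith (sphereMeasure V) (fun _ ↦ ((1 : ℝ) : ℂ)) z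

lemma norm_sphereKernel_le (z : V) : ‖sphereKernel z‖ ≤ (sphereMeasure V).real univ :=
  (norm_fourierWith_le _ _ _).trans (by simp)

lemma sphereKernel_map (U : V ≃ₗᵢ[ℝ] V) (z : V) : sphereKernel (U z) = sphereKernel z := by
  unfold sphereKernel fourierWith
  conv_lhs => rw [← map_sphereMeasure U]
  rw [show (U : V → V) = U.toHomeomorph from rfl,
    U.toHomeomorph.measurableEmbedding.integral_map]
  simp

lemma sphereKernel_eq_of_norm_eq {z w : V} (h : ‖z‖ = ‖w‖) : sphereKernel z = sphereKernel w := by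
  rw [← Submodule.reflection_sub h, sphereKernel_map]

lemma norm_fourierChar_sub_le (s t : ℝ) : ‖(𝐞 s : ℂ) - 𝐞 t‖ ≤ 2 * π * |s - t| := by
  have h : (𝐞 s : ℂ) - 𝐞 t = 𝐞 t * (Complex.exp (Complex.I * (2 * π * (s - t) : ℝ)) - 1) := by
    rw [Real.fourierChar_apply, Real.fourierChar_apply, mul_sub, ← Complex.exp_add]
    push_cast
    congr 1
    · congr 1; ring
    · simp
  rw [h, norm_mul, Circle.norm_coe, one_mul]
  refine (Real.norm_exp_I_mul_ofReal_sub_one_le).trans ?_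
  rw [Real.norm_eq_abs, abs_mul, abs_of_pos Real.two_pi_pos]

lemma norm_sphereKernel_sub_le (z w : V) :
    ‖sphereKernel z - sphereKernel w‖ ≤ 2 * π * (sphereMeasure V).real univ * ‖z - w‖ := by
  have hi : ∀ z : V, Integrable (fun x ↦ 𝐞 (-⟪x, z⟫) • ((1 : ℝ) : ℂ)) (sphereMeasure V) := by
    intro z
    refine Integrable.of_bound (C := 1) ?_ (ae_of_all _ fun x ↦ by simp)
    have := Real.continuous_fourierChar
    apply Continuous.aestronglyMeasurable
    fun_prop
  unfold sphereKernel fourierWith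
  rw [← integral_sub (hi z) (hi w)]
  refine (norm_integral_le_of_norm_le_const (C := 2 * π * ‖z - w‖) ?_).trans_eq (by ring)
  filter_upwards [ae_sphereMeasure_norm (V := V)] with x hx
  simp only [Circle.smul_def, Complex.ofReal_one, smul_eq_mul, mul_one]
  refine (norm_fourierChar_sub_le _ _).trans ?_
  gcongr
  rw [← neg_sub', ← inner_sub_right, abs_neg]
  simpa [hx] using abs_real_inner_le_norm x (z - w)

end SphereMeasure

section KernelDecay

variable {V : Type*} [NormedAddCommGroup V] [InnerProductSpace ℝ V] [FiniteDimensional ℝ V]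
  [MeasurableSpace V] [BorelSpace V]

lemma integrable_exp_neg_mul_sq_norm {b : ℝ} (hb : 0 < b) :
    Integrable fun v : V ↦ rexp (-b * ‖v‖ ^ 2) := by
  have h := (GaussianFourier.integrable_cexp_neg_mul_sq_norm_add (V := V) (b := (b : ℂ))
    (by simpa using hb) 0 0).norm
  refine h.congr (ae_of_all _ fun v ↦ ?_)
  simp only [Complex.norm_exp]
  congr 1
  simp [← Complex.ofReal_pow, ← Complex.ofReal_neg, ← Complex.ofReal_mul]

lemma rpow_sq_half {l : ℝ} (hl : 0 < l) (d : ℕ) : (l ^ 2) ^ (d / 2 : ℝ) = l ^ d := by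
  rw [← Real.rpow_natCast l 2, ← Real.rpow_mul hl.le, ← Real.rpow_natCast l d]
  congr 1
  push_cast
  ring

/-- A Gaussian of width `1 / l` has surface integral `O(l ^ (1 - d))`. -/
lemma integral_gaussian_sphereMeasure_le {l : ℝ} (hl : 0 < l) (y : V) :
    l ^ finrank ℝ V * ∫ x, rexp (-(π * l ^ 2) * ‖y - x‖ ^ 2) ∂(sphereMeasure V)
      ≤ rexp π * 2 ^ (finrank ℝ V / 2 : ℝ) * l := by
  set d := finrank ℝ V
  have hb : 0 < π * l ^ 2 / 2 := by positivity
  set h : V → ℝ := fun x ↦ rexp (-(π * l ^ 2) * ‖y - x‖ ^ 2)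
  have hcont : Continuous h := by fun_prop
  have hint : Integrable h (sphereMeasure V) :=
    Integrable.of_bound (C := 1) hcont.aestronglyMeasurable (ae_of_all _ fun x ↦ by
      simp only [h, Real.norm_eq_abs, Real.abs_exp]
      exact Real.exp_le_one_iff.2 (by rw [neg_mul]; exact neg_nonpos.2 (by positivity)))
  have hG : ∫ x : V, rexp π * rexp (-(π * l ^ 2 / 2) * ‖x - y‖ ^ 2)
      = rexp π * (2 / l ^ 2) ^ (d / 2 : ℝ) := by
    rw [integral_const_mul, integral_sub_right_eq_self
      (fun x : V ↦ rexp (-(π * l ^ 2 / 2) * ‖x‖ ^ 2)) y,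
      GaussianFourier.integral_rexp_neg_mul_sq_norm hb]
    congr 2
    field_simp
  have hGi : Integrable fun x : V ↦ rexp π * rexp (-(π * l ^ 2 / 2) * ‖x - y‖ ^ 2) :=
    ((integrable_exp_neg_mul_sq_norm hb).comp_sub_right y).const_mul _
  have key : ENNReal.ofReal (1 / l) * ∫⁻ x, ENNReal.ofReal (h x) ∂(sphereMeasure V)
      ≤ ∫⁻ x : V, ENNReal.ofReal (rexp π * rexp (-(π * l ^ 2 / 2) * ‖x - y‖ ^ 2)) := by
    apply lintegral_sphereMeasure_le_of_shell
    · fun_prop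
    · fun_prop
    · intro θ hθ r hr
      apply ENNReal.ofReal_le_ofReal
      rw [← Real.exp_add]
      apply Real.exp_le_exp.2
      have h1 : ‖r • θ - y‖ ≤ ‖y - θ‖ + 1 / l := by
        have : r • θ - y = (r - 1) • θ + (θ - y) := by rw [sub_smul, one_smul]; abel
        rw [this, norm_sub_rev y θ]
        refine (norm_add_le _ _).trans ?_
        rw [norm_smul, hθ, mul_one, Real.norm_eq_abs, abs_of_nonneg (by linarith [hr.1]), add_comm]
        gcongr
        linarith [hr.2]
      have h2 : l * ‖r • θ - y‖ ≤ l * ‖y - θ‖ + 1 := by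
        calc _ ≤ l * (‖y - θ‖ + 1 / l) := by gcongr
          _ = _ := by field_simp
      have h3 : (l * ‖r • θ - y‖) ^ 2 ≤ 2 * (l * ‖y - θ‖) ^ 2 + 2 := by
        have : (l * ‖r • θ - y‖) ^ 2 ≤ (l * ‖y - θ‖ + 1) ^ 2 := by gcongr
        nlinarith [sq_nonneg (l * ‖y - θ‖ - 1)]
      nlinarith [mul_le_mul_of_nonneg_left h3 Real.pi_pos.le]
  rw [← ofReal_integral_eq_lintegral_ofReal hint (ae_of_all _ fun x ↦ by positivity),
    ← ofReal_integral_eq_lintegral_ofReal hGi (ae_of_all _ fun x ↦ by positivity), hG,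
    ← ENNReal.ofReal_mul (by positivity), ENNReal.ofReal_le_ofReal_iff (by positivity)] at key
  have e : (2 / l ^ 2) ^ (d / 2 : ℝ) = 2 ^ (d / 2 : ℝ) / l ^ d := by
    rw [Real.div_rpow (by norm_num) (by positivity), rpow_sq_half hl]
  rw [e] at key
  have hld : 0 < l ^ d := by positivity
  calc l ^ d * ∫ x, h x ∂(sphereMeasure V)
      = l ^ d * l * (1 / l * ∫ x, h x ∂(sphereMeasure V)) := by field_simp
    _ ≤ l ^ d * l * (rexp π * (2 ^ (d / 2 : ℝ) / l ^ d)) := by gcongr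
    _ = _ := by field_simp

lemma norm_fourierWith_gaussian {l : ℝ} (hl : 0 < l) (z : V) :
    ‖fourierWith volume (fun ξ : V ↦ ((rexp (-(π / l ^ 2) * ‖ξ‖ ^ 2) : ℝ) : ℂ)) z‖
      = l ^ finrank ℝ V * rexp (-(π * l ^ 2) * ‖z‖ ^ 2) := by
  have hb : 0 < π / l ^ 2 := by positivity
  have hb' : 0 < ((π / l ^ 2 : ℝ) : ℂ).re := by rwa [Complex.ofReal_re]
  have h := fourier_gaussian_innerProductSpace (V := V) hb' z
  rw [fourierWith_volume]
  have e : (fun ξ : V ↦ ((rexp (-(π / l ^ 2) * ‖ξ‖ ^ 2) : ℝ) : ℂ))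
      = fun v : V ↦ Complex.exp (-((π / l ^ 2 : ℝ) : ℂ) * ‖v‖ ^ 2) := by
    ext v; push_cast; rfl
  rw [e, h, norm_mul]
  have e1 : (π : ℂ) / ((π / l ^ 2 : ℝ) : ℂ) = ((l ^ 2 : ℝ) : ℂ) := by
    rw [← Complex.ofReal_div]
    congr 1
    field_simp
  congr 1
  · rw [e1, Complex.norm_cpow_eq_rpow_re_of_pos (by positivity)]
    simpa using rpow_sq_half hl (finrank ℝ V)
  · rw [Complex.norm_exp]
    congr 1
    rw [← Complex.ofReal_pow, ← Complex.ofReal_pow, ← Complex.ofReal_neg, ← Complex.ofReal_mul,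
      ← Complex.ofReal_div, Complex.ofReal_re]
    field_simp

lemma integral_gaussian_mul_sphereKernel_sq_le {l : ℝ} (hl : 0 < l) :
    ∫ z : V, rexp (-(π / l ^ 2) * ‖z‖ ^ 2) * ‖sphereKernel z‖ ^ 2
      ≤ rexp π * 2 ^ (finrank ℝ V / 2 : ℝ) * l * (sphereMeasure V).real univ := by
  have h := integral_norm_fourierWith_sq_le (μ := sphereMeasure V) (ν := volume)
    (f := fun _ ↦ ((1 : ℝ) : ℂ)) (w := fun ξ ↦ rexp (-(π / l ^ 2) * ‖ξ‖ ^ 2))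
    (M := rexp π * 2 ^ (finrank ℝ V / 2 : ℝ) * l) (integrable_const _)
    (integrable_exp_neg_mul_sq_norm (by positivity)) (fun x ↦ by
      simp only [norm_fourierWith_gaussian hl]
      simp only [Complex.ofReal_one, norm_one, one_mul]
      rw [integral_const_mul]
      exact integral_gaussian_sphereMeasure_le hl x)
  simpa [sphereKernel] using h

lemma volume_real_shell_ge [Nontrivial V] {l η : ℝ} (hl : 0 < l) (hη : 0 ≤ η) :
    volume.real (ball (0 : V) 1) * (l ^ (finrank ℝ V - 1) * η)
      ≤ volume.real (ball (0 : V) (l + η) \ ball (0 : V) l) := by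
  set d := finrank ℝ V
  have hd : 1 ≤ d := Module.finrank_pos
  rw [measureReal_sdiff (ball_subset_ball (by linarith)) measurableSet_ball
    measure_ball_lt_top.ne, measureReal_def, measureReal_def, measureReal_def,
    Measure.addHaar_ball _ (0 : V) hl.le,
    Measure.addHaar_ball _ (0 : V) (by linarith : 0 ≤ l + η), ENNReal.toReal_mul,
    ENNReal.toReal_mul, ENNReal.toReal_ofReal (by positivity),
    ENNReal.toReal_ofReal (by positivity),
    ← sub_mul, mul_comm]
  gcongr
  obtain ⟨m, hm⟩ : ∃ m, d = m + 1 := ⟨d - 1, by omega⟩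
  change l ^ (d - 1) * η ≤ (l + η) ^ d - l ^ d
  rw [hm, Nat.add_sub_cancel, pow_succ, pow_succ]
  have : l ^ m ≤ (l + η) ^ m := by gcongr; linarith
  nlinarith [mul_le_mul_of_nonneg_right this (by linarith : 0 ≤ l + η)]

/-- Decay of the Fourier transform of the surface measure of the sphere. -/
lemma exists_norm_sphereKernel_decay (hd : 3 ≤ finrank ℝ V) :
    ∃ C > 0, ∀ z : V, ‖sphereKernel z‖ ≤ C ∧ ‖sphereKernel z‖ ^ 3 * ‖z‖ ≤ C := by
  have : Nontrivial V := Module.nontrivial_of_finrank_pos (R := ℝ) (by omega)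
  set d := finrank ℝ V with hd_def
  set m := (sphereMeasure V).real univ with hm_def
  have hm : 0 < m := by
    have : m = (volume : Measure V).toSphere.real univ := by
      rw [hm_def, sphereMeasure, measureReal_def, Measure.map_apply measurable_subtype_coe .univ]
      simp [measureReal_def]
    rw [this, Measure.toSphere_real_apply_univ]
    have h1 : 0 < volume.real (ball (0 : V) 1) :=
      ENNReal.toReal_pos (measure_ball_pos _ _ one_pos).ne' measure_ball_lt_top.ne
    have h2 : (0 : ℝ) < d := by exact_mod_cast (by omega : 0 < d)
    positivity
  set v := volume.real (ball (0 : V) 1) with hv_def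
  have hv : 0 < v := ENNReal.toReal_pos (measure_ball_pos _ _ one_pos).ne' measure_ball_lt_top.ne
  set C₀ := rexp π * 2 ^ (d / 2 : ℝ) * m with hC₀
  set C₁ := C₀ * 4 * rexp (4 * π) * (4 * π * m) / v with hC₁
  have hC₀pos : 0 < C₀ := by positivity
  have hC₁pos : 0 < C₁ := by positivity
  refine ⟨m + m ^ 3 + C₁, by positivity, fun z ↦ ⟨?_, ?_⟩⟩
  · have := norm_sphereKernel_le z
    have : 0 ≤ m ^ 3 := by positivity
    linarith
  rcases le_or_gt ‖z‖ 1 with hz | hz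
  · have h1 : ‖sphereKernel z‖ ^ 3 ≤ m ^ 3 := by gcongr; exact norm_sphereKernel_le z
    have : ‖sphereKernel z‖ ^ 3 * ‖z‖ ≤ m ^ 3 * 1 := by gcongr
    linarith
  set l := ‖z‖
  set a := ‖sphereKernel z‖ with ha_def
  have ha0 : 0 ≤ a := norm_nonneg _
  have ham : a ≤ m := norm_sphereKernel_le z
  have hl0 : 0 < l := by linarith
  set η := a / (4 * π * m) with hη_def
  have hη0 : 0 ≤ η := by positivity
  have hη1 : η ≤ 1 := by
    rw [hη_def, div_le_one (by positivity)]
    nlinarith [Real.pi_gt_three]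
  have hlow : ∀ w ∈ ball (0 : V) (l + η) \ ball (0 : V) l,
      rexp (-(4 * π)) * (a / 2) ^ 2
        ≤ rexp (-(π / l ^ 2) * ‖w‖ ^ 2) * ‖sphereKernel w‖ ^ 2 := by
    intro w hw
    simp only [Set.mem_sdiff, mem_ball_zero_iff, not_lt] at hw
    have hk : a / 2 ≤ ‖sphereKernel w‖ := by
      have h1 : sphereKernel w = sphereKernel ((‖w‖ / l) • z) := by
        apply sphereKernel_eq_of_norm_eq
        rw [norm_smul, Real.norm_eq_abs, abs_of_nonneg (by positivity)]
        change ‖w‖ = ‖w‖ / l * l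
        field_simp
      have h2 := norm_sphereKernel_sub_le z ((‖w‖ / l) • z)
      have h3 : ‖z - (‖w‖ / l) • z‖ = ‖w‖ - l := by
        have : z - (‖w‖ / l) • z = (1 - ‖w‖ / l) • z := by rw [sub_smul, one_smul]
        rw [this, norm_smul, Real.norm_eq_abs, abs_sub_comm, abs_of_nonneg
          (by rw [sub_nonneg, le_div_iff₀ hl0]; linarith)]
        change (‖w‖ / l - 1) * l = _
        field_simp
      rw [h3, ← h1] at h2
      have h4 : 2 * π * m * (‖w‖ - l) ≤ a / 2 := by
        calc 2 * π * m * (‖w‖ - l) ≤ 2 * π * m * η := by gcongr; linarith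
          _ = a / 2 := by rw [hη_def]; field_simp; ring
      have h5 := norm_sub_norm_le (sphereKernel z) (sphereKernel w)
      linarith
    gcongr
    have h6 : ‖w‖ ^ 2 ≤ (2 * l) ^ 2 := by gcongr; linarith
    rw [neg_mul, neg_le_neg_iff]
    calc π / l ^ 2 * ‖w‖ ^ 2 ≤ π / l ^ 2 * (2 * l) ^ 2 := by gcongr
      _ = 4 * π := by field_simp; ring
  have hintegr : Integrable fun w : V ↦ rexp (-(π / l ^ 2) * ‖w‖ ^ 2) * ‖sphereKernel w‖ ^ 2 := by
    have hc : Continuous fun w : V ↦ ‖sphereKernel w‖ ^ 2 :=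
      (continuous_fourierWith (integrable_const _)).norm.pow 2
    refine (integrable_exp_neg_mul_sq_norm (by positivity)).mul_bdd (c := m ^ 2)
      hc.aestronglyMeasurable (ae_of_all _ fun w ↦ ?_)
    rw [norm_pow, norm_norm]
    gcongr
    exact norm_sphereKernel_le w
  have hmain : rexp (-(4 * π)) * (a / 2) ^ 2 * (v * (l ^ (d - 1) * η)) ≤ C₀ * l := by
    calc rexp (-(4 * π)) * (a / 2) ^ 2 * (v * (l ^ (d - 1) * η))
        ≤ rexp (-(4 * π)) * (a / 2) ^ 2 * volume.real (ball (0 : V) (l + η) \ ball (0 : V) l) := by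
          gcongr
          exact volume_real_shell_ge hl0 hη0
      _ ≤ ∫ w in ball (0 : V) (l + η) \ ball (0 : V) l,
            rexp (-(π / l ^ 2) * ‖w‖ ^ 2) * ‖sphereKernel w‖ ^ 2 := by
          apply setIntegral_ge_of_const_le_real (measurableSet_ball.diff measurableSet_ball)
            (measure_ne_top_of_subset Set.sdiff_subset measure_ball_lt_top.ne) hlow
            hintegr.integrableOn
      _ ≤ ∫ w : V, rexp (-(π / l ^ 2) * ‖w‖ ^ 2) * ‖sphereKernel w‖ ^ 2 :=
          setIntegral_le_integral hintegr (ae_of_all _ fun w ↦ by positivity)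
      _ ≤ C₀ * l := by
          refine (integral_gaussian_mul_sphereKernel_sq_le hl0).trans_eq ?_
          rw [hC₀]; ring
  have hpow : l * l ≤ l ^ (d - 1) := by
    rw [← pow_two]
    exact pow_le_pow_right₀ hz.le (by omega)
  have h7 : rexp (-(4 * π)) * (a / 2) ^ 2 * (v * (l * l * η)) ≤ C₀ * l :=
    le_trans (by gcongr) hmain
  have h8 : a ^ 3 * l ≤ C₁ := by
    rw [Real.exp_neg, hη_def] at h7
    rw [hC₁, le_div_iff₀ hv]
    have h9 : a ^ 3 * l * v * l ≤ C₀ * 4 * rexp (4 * π) * (4 * π * m) * l := by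
      calc a ^ 3 * l * v * l
          = ((rexp (4 * π))⁻¹ * (a / 2) ^ 2 * (v * (l * l * (a / (4 * π * m)))))
            * (4 * rexp (4 * π) * (4 * π * m)) := by field_simp; norm_num
        _ ≤ C₀ * l * (4 * rexp (4 * π) * (4 * π * m)) := by gcongr
        _ = _ := by ring
    exact le_of_mul_le_mul_right h9 hl0
  have : 0 ≤ m ^ 3 := by positivity
  linarith

end KernelDecay

section Restriction

variable {V : Type*} [NormedAddCommGroup V] [InnerProductSpace ℝ V] [FiniteDimensional ℝ V]
  [MeasurableSpace V] [BorelSpace V]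

lemma fourierWith_map_smul_sphereMeasure (r : ℝ) (z : V) :
    fourierWith ((sphereMeasure V).map (r • ·)) (fun _ ↦ ((1 : ℝ) : ℂ)) z
      = sphereKernel (r • z) := by
  have := Real.continuous_fourierChar
  rw [sphereKernel, fourierWith, fourierWith, integral_map (by fun_prop)]
  · simp only [real_inner_smul_left, real_inner_smul_right]
  · apply Continuous.aestronglyMeasurable
    fun_prop

/-- An `L²` restriction estimate for functions with given sup and `L¹` norms. -/
lemma exists_integral_sphere_fourier_sq_le (hd : 3 ≤ finrank ℝ V) :
    ∃ C > 0, ∀ (g : V → ℂ) (H B r s : ℝ), Integrable g → (∀ x, ‖g x‖ ≤ H) → ∫ x, ‖g x‖ ≤ B →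
      0 < r → 0 < s →
      ∫ θ, ‖𝓕 g (r • θ)‖ ^ 2 ∂(sphereMeasure V)
        ≤ C * (H * (s / r) ^ finrank ℝ V + s ^ (-(1 / 3) : ℝ) * B) * B := by
  have : Nontrivial V := Module.nontrivial_of_finrank_pos (R := ℝ) (by omega)
  obtain ⟨C₀, hC₀, hK⟩ := exists_norm_sphereKernel_decay hd
  set C := max C₀ 1
  have hC1 : 1 ≤ C := le_max_right _ _
  have hCpos : 0 < C := by linarith
  have hKC : ∀ z : V, ‖sphereKernel z‖ ≤ C ∧ ‖sphereKernel z‖ ^ 3 * ‖z‖ ≤ C := fun z ↦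
    ⟨(hK z).1.trans (le_max_left _ _), (hK z).2.trans (le_max_left _ _)⟩
  set v := volume.real (ball (0 : V) 1)
  set d := finrank ℝ V
  refine ⟨C * (v + 1), by positivity, fun g H B r s hg hH hB hr hs ↦ ?_⟩
  have hH0 : 0 ≤ H := (norm_nonneg _).trans (hH 0)
  have hB0 : 0 ≤ B := (integral_nonneg fun x ↦ norm_nonneg _).trans hB
  set q := s ^ (-(1 / 3) : ℝ) with hq
  have hq0 : 0 < q := by positivity
  have hq3 : q ^ 3 = 1 / s := by
    rw [hq, ← Real.rpow_natCast, ← Real.rpow_mul hs.le]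
    norm_num [Real.rpow_neg_one]
  have hfar : ∀ z : V, s / r ≤ ‖z‖ → ‖sphereKernel (r • z)‖ ≤ C * q := by
    intro z hz
    by_contra! hcon
    have h1 := (hKC (r • z)).2
    rw [norm_smul, Real.norm_eq_abs, abs_of_pos hr] at h1
    have h2 : s ≤ r * ‖z‖ := by rw [div_le_iff₀ hr] at hz; linarith
    have h3 : (C * q) ^ 3 < ‖sphereKernel (r • z)‖ ^ 3 := by gcongr
    have h4 : (C * q) ^ 3 * s = C ^ 3 := by rw [mul_pow, hq3]; field_simp
    have h5 : C ≤ C ^ 3 := le_self_pow₀ hC1 (by norm_num)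
    have h6 : (C * q) ^ 3 * s < ‖sphereKernel (r • z)‖ ^ 3 * (r * ‖z‖) := by
      calc _ < ‖sphereKernel (r • z)‖ ^ 3 * s := by gcongr
        _ ≤ _ := by gcongr
    linarith
  have hν : ∀ z : V, fourierWith ((sphereMeasure V).map (r • ·))
      (fun ξ ↦ (((fun _ ↦ 1 : V → ℝ) ξ : ℝ) : ℂ)) z = sphereKernel (r • z) :=
    fourierWith_map_smul_sphereMeasure r
  have : IsFiniteMeasure ((sphereMeasure V).map (r • ·)) := by infer_instance
  have h := integral_norm_fourierWith_sq_le (μ := volume)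
    (ν := (sphereMeasure V).map (r • ·)) (f := g) (w := fun _ ↦ 1)
    (M := C * (v + 1) * (H * (s / r) ^ d + q * B)) hg (integrable_const _) (fun x ↦ by
      simp only [hν]
      have hball : ∫ y, (ball x (s / r)).indicator (fun _ ↦ C * H) y
          = C * H * (v * (s / r) ^ d) := by
        rw [integral_indicator measurableSet_ball, setIntegral_const, smul_eq_mul,
          measureReal_def, Measure.addHaar_ball _ _ (by positivity), ENNReal.toReal_mul,
          ENNReal.toReal_ofReal (by positivity)]
        change (s / r) ^ d * v * (C * H) = _
        ring
      have hi1 : Integrable ((ball x (s / r)).indicator (fun _ ↦ C * H)) :=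
        (integrable_indicator_iff measurableSet_ball).2
          (integrableOn_const measure_ball_lt_top.ne)
      have hi2 : Integrable fun y ↦ C * q * ‖g y‖ := hg.norm.const_mul _
      calc ∫ y, ‖g y‖ * ‖sphereKernel (r • (x - y))‖
          ≤ ∫ y, ((ball x (s / r)).indicator (fun _ ↦ C * H) y + C * q * ‖g y‖) := by
            refine integral_mono_of_nonneg (ae_of_all _ fun y ↦ by positivity) (hi1.add hi2)
              (ae_of_all _ fun y ↦ ?_)
            by_cases hy : y ∈ ball x (s / r)
            · simp only [indicator_of_mem hy]
              have : ‖g y‖ * ‖sphereKernel (r • (x - y))‖ ≤ H * C := by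
                gcongr
                · exact hH y
                · exact (hKC _).1
              have : 0 ≤ C * q * ‖g y‖ := by positivity
              linarith
            · simp only [indicator_of_notMem hy, zero_add]
              rw [mul_comm]
              gcongr
              apply hfar
              rw [mem_ball, dist_eq_norm, norm_sub_rev] at hy
              linarith
        _ = C * H * (v * (s / r) ^ d) + C * q * ∫ y, ‖g y‖ := by
            rw [integral_add hi1 hi2, hball, integral_const_mul]
        _ ≤ C * H * (v * (s / r) ^ d) + C * q * B := by gcongr
        _ ≤ _ := by
            have h1 : 0 ≤ v := measureReal_nonneg
            have h2 : 0 ≤ C * H * (s / r) ^ d := by positivity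
            have h3 : 0 ≤ C * q * B * v := by positivity
            nlinarith)
  simp only [one_mul] at h
  rw [fourierWith_volume, integral_map (by fun_prop)
    (by
      apply Continuous.aestronglyMeasurable
      exact (continuous_fourierWith hg).norm.pow 2)] at h
  refine h.trans ?_
  gcongr

end Restriction

section Differences

variable {V : Type*} [NormedAddCommGroup V] [InnerProductSpace ℝ V] [FiniteDimensional ℝ V]
  [MeasurableSpace V] [BorelSpace V]

/-- Translations move a `C¹` function in `L¹` by at most the translation length times the `L¹` norm
of the derivative. -/
lemma lintegral_enorm_translate_sub_le {g : V → ℝ} (hg : ContDiff ℝ 1 g) (h : V) :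
    ∫⁻ x, ‖g (x + h) - g x‖ₑ ≤ ‖h‖ₑ * ∫⁻ x, ‖fderiv ℝ g x‖ₑ := by
  have hc : Continuous (fderiv ℝ g) := hg.continuous_fderiv one_ne_zero
  have hm : Measurable fun p : V × ℝ ↦ ‖fderiv ℝ g (p.1 + p.2 • h)‖ₑ := by
    apply Continuous.measurable
    have : Continuous fun p : V × ℝ ↦ fderiv ℝ g (p.1 + p.2 • h) := hc.comp (by fun_prop)
    exact continuous_enorm.comp this
  have hpt : ∀ x, ‖g (x + h) - g x‖ₑ ≤ ∫⁻ t in Ioc (0 : ℝ) 1, ‖h‖ₑ * ‖fderiv ℝ g (x + t • h)‖ₑ := by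
    intro x
    have hd : ∀ t : ℝ, HasDerivAt (fun t : ℝ ↦ g (x + t • h)) (fderiv ℝ g (x + t • h) h) t := by
      intro t
      have h1 : HasDerivAt (fun t : ℝ ↦ x + t • h) h t := by
        simpa using ((hasDerivAt_id t).smul_const h).const_add x
      exact ((hg.differentiable one_ne_zero _).hasFDerivAt.comp_hasDerivAt t h1)
    have hcont : Continuous fun t : ℝ ↦ fderiv ℝ g (x + t • h) h :=
      (hc.comp (by fun_prop)).clm_apply continuous_const
    have hftc := intervalIntegral.integral_eq_sub_of_hasDerivAt (a := 0) (b := 1)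
      (fun t _ ↦ hd t) (hcont.intervalIntegrable _ _)
    simp only [one_smul, zero_smul, add_zero] at hftc
    rw [← hftc, intervalIntegral.integral_of_le zero_le_one]
    refine (enorm_integral_le_lintegral_enorm _).trans (lintegral_mono fun t ↦ ?_)
    rw [mul_comm]
    exact ContinuousLinearMap.le_opENorm _ _
  calc ∫⁻ x, ‖g (x + h) - g x‖ₑ
      ≤ ∫⁻ x, ∫⁻ t in Ioc (0 : ℝ) 1, ‖h‖ₑ * ‖fderiv ℝ g (x + t • h)‖ₑ := lintegral_mono hpt
    _ = ∫⁻ t in Ioc (0 : ℝ) 1, ∫⁻ x, ‖h‖ₑ * ‖fderiv ℝ g (x + t • h)‖ₑ :=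
        lintegral_lintegral_swap (hm.const_mul _).aemeasurable
    _ = ∫⁻ t in Ioc (0 : ℝ) 1, ‖h‖ₑ * ∫⁻ x, ‖fderiv ℝ g x‖ₑ := by
        congr 1 with t
        have hct : Continuous fun x ↦ fderiv ℝ g (x + t • h) := hc.comp (by fun_prop)
        have hmt : Measurable fun x ↦ ‖fderiv ℝ g (x + t • h)‖ₑ :=
          (continuous_enorm.comp hct).measurable
        rw [lintegral_const_mul _ hmt,
          lintegral_add_right_eq_self (fun x ↦ ‖fderiv ℝ g x‖ₑ)]
    _ = _ := by simp

lemma integrable_fderiv_of_compactSupport {g : V → ℝ} (hg : ContDiff ℝ 1 g)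
    (hgs : HasCompactSupport g) : Integrable (fderiv ℝ g) :=
  (hg.continuous_fderiv one_ne_zero).integrable_of_hasCompactSupport (hgs.fderiv ℝ)

lemma integral_norm_translate_sub_le {g : V → ℝ} (hg : ContDiff ℝ 1 g)
    (hgs : HasCompactSupport g) (h : V) :
    ∫ x, ‖g (x + h) - g x‖ ≤ ‖h‖ * ∫ x, ‖fderiv ℝ g x‖ := by
  have hi := integrable_fderiv_of_compactSupport hg hgs
  have hc := hg.continuous
  rw [integral_norm_eq_lintegral_enorm (by fun_prop), integral_norm_eq_lintegral_enorm hi.1,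
    ← toReal_enorm h, ← ENNReal.toReal_mul]
  exact ENNReal.toReal_mono (ENNReal.mul_ne_top (by simp) hi.2.ne)
    (lintegral_enorm_translate_sub_le hg h)

lemma fourier_translate_sub {g : V → ℂ} (hg : Integrable g) (h ξ : V) :
    𝓕 (fun x ↦ g (x + h) - g x) ξ = ((𝐞 ⟪h, ξ⟫ : ℂ) - 1) * 𝓕 g ξ := by
  have h1 : 𝓕 (fun x ↦ g (x + h)) ξ = 𝐞 ⟪h, ξ⟫ • 𝓕 g ξ :=
    congrFun (VectorFourier.fourierIntegral_comp_add_right 𝐞 volume (innerₗ V) g h) ξ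
  have h2 : 𝓕 (fun x ↦ g (x + h) - g x) ξ = 𝓕 (fun x ↦ g (x + h)) ξ - 𝓕 g ξ := by
    simp only [Real.fourier_eq, smul_sub]
    exact integral_sub ((Real.fourierIntegral_convergent_iff ξ).2 (hg.comp_add_right h))
      ((Real.fourierIntegral_convergent_iff ξ).2 hg)
  rw [h2, h1, Circle.smul_def, smul_eq_mul]
  ring

lemma abs_le_norm_fourierChar_div_four_sub_one {s : ℝ} (hs : |s| ≤ 1) :
    |s| ≤ ‖(𝐞 (s / 4) : ℂ) - 1‖ := by
  have h1 : (𝐞 (s / 4) : ℂ) = Complex.exp (Complex.I * ((2 * π * (s / 4) : ℝ) : ℂ)) := by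
    rw [Real.fourierChar_apply, mul_comm]
  rw [h1, Complex.norm_exp_I_mul_ofReal_sub_one, norm_mul, Real.norm_two, Real.norm_eq_abs]
  have h2 : |sin (2 * π * (s / 4) / 2)| = |sin (π * |s| / 4)| := by
    rcases abs_cases s with ⟨h, _⟩ | ⟨h, _⟩ <;> rw [h]
    · ring_nf
    · rw [show π * -s / 4 = -(2 * π * (s / 4) / 2) by ring, sin_neg, abs_neg]
  have hpi := Real.pi_pos
  have h3 := Real.mul_le_sin (x := π * |s| / 4) (by positivity) (by nlinarith)
  have h4 : 2 / π * (π * |s| / 4) = |s| / 2 := by field_simp; ring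
  rw [h2]
  linarith [le_abs_self (sin (π * |s| / 4))]

/-- On the sphere of radius `r`, the Fourier transform is controlled by those of the differences at
scale `1 / (4 r)` in the directions of an orthonormal basis. -/
lemma norm_fourier_sq_le_sum_differences {ι : Type*} [Fintype ι] (b : OrthonormalBasis ι ℝ V)
    {g : V → ℂ} (hg : Integrable g) {r : ℝ} (hr : 0 < r) {θ : V} (hθ : ‖θ‖ = 1) :
    ‖𝓕 g (r • θ)‖ ^ 2
      ≤ ∑ i, ‖𝓕 (fun x ↦ g (x + (1 / (4 * r)) • b i) - g x) (r • θ)‖ ^ 2 := by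
  have hsum : ∑ i, ⟪b i, θ⟫ ^ 2 = 1 := by
    have := b.sum_sq_norm_inner_right θ
    simpa [hθ] using this
  calc ‖𝓕 g (r • θ)‖ ^ 2 = ∑ i, ⟪b i, θ⟫ ^ 2 * ‖𝓕 g (r • θ)‖ ^ 2 := by
        rw [← Finset.sum_mul, hsum, one_mul]
    _ ≤ _ := by
        refine Finset.sum_le_sum fun i _ ↦ ?_
        rw [fourier_translate_sub hg, norm_mul, mul_pow]
        refine mul_le_mul_of_nonneg_right ?_ (sq_nonneg _)
        rw [← sq_abs]
        gcongr
        have h1 : ⟪(1 / (4 * r)) • b i, r • θ⟫ = ⟪b i, θ⟫ / 4 := by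
          rw [real_inner_smul_left, real_inner_smul_right]; field_simp
        rw [h1]
        refine abs_le_norm_fourierChar_div_four_sub_one ?_
        refine (abs_real_inner_le_norm _ _).trans ?_
        simp [hθ]

end Differences

section FrequencyRegimes

variable {V : Type*} [NormedAddCommGroup V] [InnerProductSpace ℝ V] [FiniteDimensional ℝ V]
  [MeasurableSpace V] [BorelSpace V]

lemma exists_integral_sphere_fourier_le_of_high_frequency (hd : 3 ≤ finrank ℝ V) :
    ∃ C > 0, ∀ (g : V → ℝ) (A R r : ℝ), ContDiff ℝ 1 g → HasCompactSupport g →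
      (∀ x, ‖g x‖ ≤ A * R ^ (finrank ℝ V - 1)) → ∫ x, ‖fderiv ℝ g x‖ ≤ A →
      0 < A → 0 < R → R ≤ r →
      r * ∫ θ, ‖𝓕 (fun x ↦ (g x : ℂ)) (r • θ)‖ ∂(sphereMeasure V)
        ≤ C * A * (r / R) ^ (-(1 / 18) : ℝ) := by
  obtain ⟨C, hC, hres⟩ := exists_integral_sphere_fourier_sq_le hd
  set d := finrank ℝ V with hdef
  set σ := (sphereMeasure V).real univ
  refine ⟨σ + 3 * d * C, by positivity, fun g A R r hg hgs hH hA hA0 hR hRr ↦ ?_⟩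
  have hr : 0 < r := hR.trans_le hRr
  set u := r / R with hu
  have hu1 : 1 ≤ u := (one_le_div hR).2 hRr
  have hu0 : 0 < u := by linarith
  set w := u ^ (1 / 18 : ℝ) with hw
  have hw1 : 1 ≤ w := Real.one_le_rpow hu1 (by norm_num)
  have hw0 : 0 < w := by linarith
  have hwinv : u ^ (-(1 / 18) : ℝ) = w⁻¹ := Real.rpow_neg hu0.le _
  have hwu : w ^ 18 = u := by
    rw [hw, ← Real.rpow_natCast, ← Real.rpow_mul hu0.le]; norm_num
  have hs : (w ^ 6) ^ (-(1 / 3) : ℝ) = (w ^ 2)⁻¹ := by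
    rw [← Real.rpow_natCast, ← Real.rpow_mul hw0.le, ← Real.rpow_natCast, ← Real.rpow_neg hw0.le]
    norm_num
  have hgc := hg.continuous
  have hgi : Integrable g := hgc.integrable_of_hasCompactSupport hgs
  set G : V → ℂ := fun x ↦ (g x : ℂ)
  have hGi : Integrable G := hgi.ofReal
  set b := stdOrthonormalBasis ℝ V
  set G' : Fin d → V → ℂ := fun i x ↦ G (x + (1 / (4 * r)) • b i) - G x
  have hG'i : ∀ i, Integrable (G' i) := fun i ↦ (hGi.comp_add_right _).sub hGi
  have hcont : ∀ {F : V → ℂ}, Integrable F → Continuous fun θ ↦ ‖𝓕 F (r • θ)‖ := by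
    intro F hF
    have := continuous_fourierWith hF
    rw [fourierWith_volume] at this
    exact (this.comp (by fun_prop)).norm
  have hbdd : ∀ {F : V → ℂ}, Integrable F → ∀ θ, ‖𝓕 F (r • θ)‖ ≤ ∫ x, ‖F x‖ :=
    fun {F} _ θ ↦ by rw [← fourierWith_volume]; exact norm_fourierWith_le _ _ _
  have hint : ∀ {F : V → ℂ}, Integrable F →
      Integrable (fun θ ↦ ‖𝓕 F (r • θ)‖) (sphereMeasure V) := fun {F} hF ↦
    Integrable.of_bound (hcont hF).aestronglyMeasurable (∫ x, ‖F x‖)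
      (ae_of_all _ fun θ ↦ by rw [norm_norm]; exact hbdd hF θ)
  have hint2 : ∀ {F : V → ℂ}, Integrable F →
      Integrable (fun θ ↦ ‖𝓕 F (r • θ)‖ ^ 2) (sphereMeasure V) := fun {F} hF ↦
    Integrable.of_bound ((hcont hF).pow 2).aestronglyMeasurable ((∫ x, ‖F x‖) ^ 2)
      (ae_of_all _ fun θ ↦ by
        rw [norm_pow, norm_norm]
        have := hbdd hF θ
        gcongr)
  have hpiece : ∀ i, ∫ θ, ‖𝓕 (G' i) (r • θ)‖ ^ 2 ∂(sphereMeasure V)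
      ≤ 3 * C * (A / r) ^ 2 * (w ^ 2)⁻¹ := by
    intro i
    have hnorm : ∀ x, ‖G' i x‖ = ‖g (x + (1 / (4 * r)) • b i) - g x‖ := fun x ↦ by
      simp only [G', G, ← Complex.ofReal_sub, Complex.norm_real]
    have h1 := hres (G' i) (2 * (A * R ^ (d - 1))) (A / r) r (w ^ 6) (hG'i i)
      (fun x ↦ by
        rw [hnorm]
        refine (norm_sub_le _ _).trans ?_
        linarith [hH x, hH (x + (1 / (4 * r)) • b i)])
      (by
        simp only [hnorm]
        refine (integral_norm_translate_sub_le hg hgs _).trans ?_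
        rw [norm_smul, b.norm_eq_one, mul_one, Real.norm_eq_abs, abs_of_pos (by positivity)]
        calc 1 / (4 * r) * ∫ x, ‖fderiv ℝ g x‖ ≤ 1 / (4 * r) * A := by gcongr
          _ = A / r / 4 := by field_simp
          _ ≤ A / r := by linarith [show 0 < A / r by positivity])
      hr (by positivity)
    refine h1.trans ?_
    have h2 : A * R ^ (d - 1) * (w ^ 6 / r) ^ d ≤ A / r * (w ^ 2)⁻¹ := by
      have hd1 : d = (d - 1) + 1 := by omega
      have h3 : R ^ (d - 1) = r ^ (d - 1) / w ^ (18 * (d - 1)) := by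
        rw [pow_mul, hwu, hu, div_pow]
        field_simp
      have h4 : (w ^ 6 / r) ^ d = w ^ (6 * d) / (r ^ (d - 1) * r) := by
        rw [div_pow, ← pow_mul, ← pow_succ, ← hd1]
      have h5 : w ^ (6 * d) * w ^ 2 ≤ w ^ (18 * (d - 1)) := by
        rw [← pow_add]
        exact pow_le_pow_right₀ hw1 (by omega)
      rw [h3, h4]
      have h6 : A * (r ^ (d - 1) / w ^ (18 * (d - 1))) * (w ^ (6 * d) / (r ^ (d - 1) * r))
          = A / r * (w ^ (6 * d) / w ^ (18 * (d - 1))) := by field_simp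
      rw [h6]
      gcongr
      rw [div_le_iff₀ (by positivity), inv_mul_eq_div, le_div_iff₀ (by positivity)]
      exact h5
    rw [hs]
    calc C * (2 * (A * R ^ (d - 1)) * (w ^ 6 / r) ^ d + (w ^ 2)⁻¹ * (A / r)) * (A / r)
        = C * (2 * (A * R ^ (d - 1) * (w ^ 6 / r) ^ d) + (w ^ 2)⁻¹ * (A / r)) * (A / r) := by ring
      _ ≤ C * (2 * (A / r * (w ^ 2)⁻¹) + (w ^ 2)⁻¹ * (A / r)) * (A / r) := by gcongr
      _ = _ := by ring
  have hsq : ∫ θ, ‖𝓕 G (r • θ)‖ ^ 2 ∂(sphereMeasure V) ≤ 3 * d * C * (A / r) ^ 2 * (w ^ 2)⁻¹ := by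
    calc ∫ θ, ‖𝓕 G (r • θ)‖ ^ 2 ∂(sphereMeasure V)
        ≤ ∫ θ, ∑ i, ‖𝓕 (G' i) (r • θ)‖ ^ 2 ∂(sphereMeasure V) := by
          refine integral_mono_ae (hint2 hGi) (integrable_finsetSum _ fun i _ ↦ hint2 (hG'i i)) ?_
          filter_upwards [ae_sphereMeasure_norm (V := V)] with θ hθ
          exact norm_fourier_sq_le_sum_differences b hGi hr hθ
      _ = ∑ i, ∫ θ, ‖𝓕 (G' i) (r • θ)‖ ^ 2 ∂(sphereMeasure V) :=
          integral_finsetSum _ fun i _ ↦ hint2 (hG'i i)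
      _ ≤ ∑ i : Fin d, 3 * C * (A / r) ^ 2 * (w ^ 2)⁻¹ := Finset.sum_le_sum fun i _ ↦ hpiece i
      _ = _ := by simp; ring
  set Q := A / r * w⁻¹ with hQ
  have hQ0 : 0 < Q := by positivity
  have hQ2 : (A / r) ^ 2 * (w ^ 2)⁻¹ = Q ^ 2 := by rw [hQ, mul_pow, inv_pow]
  have hfin : ∫ θ, ‖𝓕 G (r • θ)‖ ∂(sphereMeasure V) ≤ (σ + 3 * d * C) * Q := by
    calc ∫ θ, ‖𝓕 G (r • θ)‖ ∂(sphereMeasure V)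
        ≤ ∫ θ, (Q + Q⁻¹ * ‖𝓕 G (r • θ)‖ ^ 2) ∂(sphereMeasure V) := by
          refine integral_mono (hint hGi) ((integrable_const _).add ((hint2 hGi).const_mul _))
            fun θ ↦ ?_
          simp only
          set y := ‖𝓕 G (r • θ)‖
          rw [inv_mul_eq_div, ← sub_nonneg, show Q + y ^ 2 / Q - y = (Q ^ 2 + y ^ 2 - y * Q) / Q by
            field_simp]
          apply div_nonneg _ hQ0.le
          nlinarith [sq_nonneg (Q - y), sq_nonneg (Q + y)]
      _ = σ * Q + Q⁻¹ * ∫ θ, ‖𝓕 G (r • θ)‖ ^ 2 ∂(sphereMeasure V) := by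
          rw [integral_add (integrable_const _) ((hint2 hGi).const_mul _), integral_const,
            integral_const_mul, smul_eq_mul]
      _ ≤ σ * Q + Q⁻¹ * (3 * d * C * Q ^ 2) := by
          rw [mul_assoc _ ((A / r) ^ 2), hQ2] at hsq
          gcongr
      _ = _ := by field_simp
  calc r * ∫ θ, ‖𝓕 G (r • θ)‖ ∂(sphereMeasure V) ≤ r * ((σ + 3 * d * C) * Q) := by gcongr
    _ = _ := by rw [hwinv, hQ]; field_simp

lemma integral_sphere_fourier_le_of_low_frequency {g : V → ℝ} {A R r : ℝ}
    (hg : ∫ x, ‖g x‖ ≤ A / R) (hr : 0 ≤ r) :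
    r * ∫ θ, ‖𝓕 (fun x ↦ (g x : ℂ)) (r • θ)‖ ∂(sphereMeasure V)
      ≤ (sphereMeasure V).real univ * A * (r / R) := by
  have h1 : ∫ θ, ‖𝓕 (fun x ↦ (g x : ℂ)) (r • θ)‖ ∂(sphereMeasure V)
      ≤ ∫ θ, A / R ∂(sphereMeasure V) := by
    refine integral_mono_of_nonneg (ae_of_all _ fun θ ↦ norm_nonneg _) (integrable_const _)
      (ae_of_all _ fun θ ↦ ?_)
    simp only
    rw [← fourierWith_volume]
    refine (norm_fourierWith_le _ _ _).trans ?_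
    simpa using hg
  rw [integral_const, smul_eq_mul] at h1
  calc _ ≤ r * ((sphereMeasure V).real univ * (A / R)) := by gcongr
    _ = _ := by ring

end FrequencyRegimes

section DyadicSum

variable {V : Type*} [NormedAddCommGroup V] [InnerProductSpace ℝ V] [FiniteDimensional ℝ V]
  [MeasurableSpace V] [BorelSpace V]

/-- The dyadic supremum of `r ∫ |f̂ (r θ)| dσ(θ)` over `2 ^ k ≤ r ≤ 2 ^ (k + 1)`. -/
def dyadicSphereSup (F : V → ℂ) (k : ℤ) : ℝ≥0∞ :=
  ⨆ (r : ℝ) (_ : r ∈ Icc ((2 : ℝ) ^ k) ((2 : ℝ) ^ (k + 1))),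
    ENNReal.ofReal r * ∫⁻ θ, ‖𝓕 F (r • θ)‖ₑ ∂(sphereMeasure V)

lemma ofReal_mul_lintegral_enorm_fourier {F : V → ℂ} (hF : Integrable F) {r : ℝ} (hr : 0 ≤ r) :
    ENNReal.ofReal r * ∫⁻ θ, ‖𝓕 F (r • θ)‖ₑ ∂(sphereMeasure V)
      = ENNReal.ofReal (r * ∫ θ, ‖𝓕 F (r • θ)‖ ∂(sphereMeasure V)) := by
  have hc := continuous_fourierWith hF
  rw [fourierWith_volume] at hc
  have hc' : Continuous fun θ ↦ 𝓕 F (r • θ) := hc.comp (by fun_prop)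
  have hi : Integrable (fun θ ↦ 𝓕 F (r • θ)) (sphereMeasure V) :=
    Integrable.of_bound hc'.aestronglyMeasurable (∫ x, ‖F x‖)
      (ae_of_all _ fun θ ↦ by rw [← fourierWith_volume]; exact norm_fourierWith_le _ _ _)
  rw [ENNReal.ofReal_mul hr, ofReal_integral_norm_eq_lintegral_enorm hi]

lemma summable_pow_natAbs {x : ℝ} (h0 : 0 ≤ x) (h1 : x < 1) :
    Summable fun k : ℤ ↦ x ^ k.natAbs :=
  Summable.of_nat_of_neg (by simpa using summable_geometric_of_lt_one h0 h1)
    (by simpa using summable_geometric_of_lt_one h0 h1)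

/-- The dyadic estimate for a function with one amplitude `A * R ^ (d - 1)` and one length scale
`1 / R`. -/
lemma exists_tsum_dyadicSphereSup_le_of_single_scale (hd : 3 ≤ finrank ℝ V) :
    ∃ C > 0, ∀ (g : V → ℝ) (A R : ℝ), ContDiff ℝ 1 g → HasCompactSupport g →
      (∀ x, ‖g x‖ ≤ A * R ^ (finrank ℝ V - 1)) → ∫ x, ‖fderiv ℝ g x‖ ≤ A →
      ∫ x, ‖g x‖ ≤ A / R → 0 < A → 0 < R →
      ∑' k, dyadicSphereSup (fun x ↦ (g x : ℂ)) k ≤ ENNReal.ofReal (C * A) := by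
  obtain ⟨C₁, hC₁, hhigh⟩ := exists_integral_sphere_fourier_le_of_high_frequency hd
  set σ := (sphereMeasure V).real univ
  have hσ : 0 ≤ σ := measureReal_nonneg
  set C := C₁ + σ
  set x : ℝ := 2 ^ (-(1 / 18) : ℝ) with hx
  have hx0 : 0 < x := by positivity
  have hx1 : x < 1 := Real.rpow_lt_one_of_one_lt_of_neg (by norm_num) (by norm_num)
  have hx2 : 2⁻¹ ≤ x := by
    rw [hx, ← Real.rpow_neg_one 2]
    exact Real.rpow_le_rpow_of_exponent_le (by norm_num) (by norm_num)
  have hsum := summable_pow_natAbs hx0.le hx1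
  set S := ∑' k : ℤ, x ^ k.natAbs
  have hS : 0 < S := hsum.tsum_pos (fun k ↦ by positivity) 0 (by simp)
  refine ⟨C * (2 * x⁻¹) * S, by positivity, fun g A R hg hgs hH hA hL hA0 hR ↦ ?_⟩
  obtain ⟨q, hq1, hq2⟩ := exists_mem_Ico_zpow hR (one_lt_two (α := ℝ))
  have hgi : Integrable (fun x ↦ (g x : ℂ)) :=
    (hg.continuous.integrable_of_hasCompactSupport hgs).ofReal
  have hk : ∀ k, dyadicSphereSup (fun x ↦ (g x : ℂ)) k
      ≤ ENNReal.ofReal (C * (2 * x⁻¹) * A * x ^ (k - q).natAbs) := by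
    intro k
    refine iSup₂_le fun r hr ↦ ?_
    have hr0 : 0 < r := (zpow_pos two_pos k).trans_le hr.1
    rw [ofReal_mul_lintegral_enorm_fourier hgi hr0.le]
    apply ENNReal.ofReal_le_ofReal
    rcases le_or_gt k q with hkq | hkq
    · obtain ⟨m, hm⟩ := Int.le.dest hkq
      have hm' : (k - q).natAbs = m := by omega
      refine (integral_sphere_fourier_le_of_low_frequency hL hr0.le).trans ?_
      have h1 : r / R ≤ 2 * x ^ m := by
        calc r / R ≤ 2 ^ (k + 1) / 2 ^ q := by
              gcongr
              exact hr.2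
          _ = 2 * 2⁻¹ ^ m := by
              rw [← hm, zpow_add₀ two_ne_zero, zpow_add₀ two_ne_zero, zpow_natCast, inv_pow]
              field_simp
          _ ≤ _ := by gcongr
      rw [hm']
      have h2 : 1 ≤ x⁻¹ := (one_le_inv₀ hx0).2 hx1.le
      calc σ * A * (r / R) ≤ C * A * (2 * x ^ m) := by
            gcongr
            linarith
        _ = C * (2 * 1) * A * x ^ m := by ring
        _ ≤ _ := by gcongr
    · obtain ⟨m, hm⟩ := Int.le.dest (Int.add_one_le_iff.2 hkq)
      have hm' : (k - q).natAbs = m + 1 := by omega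
      have h0 : (2 : ℝ) ^ k = 2 ^ (q + 1) * 2 ^ m := by
        rw [← hm, zpow_add₀ two_ne_zero, zpow_natCast]
      have h1 : (2 : ℝ) ^ m ≤ r / R := by
        rw [le_div_iff₀ hR]
        calc (2 : ℝ) ^ m * R ≤ 2 ^ m * 2 ^ (q + 1) := by gcongr
          _ = 2 ^ k := by rw [h0, mul_comm]
          _ ≤ r := hr.1
      have hRr : R ≤ r := by
        have : 1 ≤ r / R := (one_le_pow₀ one_le_two).trans h1
        exact (one_le_div hR).1 this
      refine (hhigh g A R r hg hgs hH hA hA0 hR hRr).trans ?_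
      have h2 : (r / R) ^ (-(1 / 18) : ℝ) ≤ x ^ m := by
        calc (r / R) ^ (-(1 / 18) : ℝ) ≤ ((2 : ℝ) ^ m) ^ (-(1 / 18) : ℝ) :=
              Real.rpow_le_rpow_of_nonpos (by positivity) h1 (by norm_num)
          _ = _ := by
              rw [hx, ← Real.rpow_natCast, ← Real.rpow_natCast, ← Real.rpow_mul two_pos.le,
                ← Real.rpow_mul two_pos.le, mul_comm]
      rw [hm']
      calc C₁ * A * (r / R) ^ (-(1 / 18) : ℝ) ≤ C * A * x ^ m := by
            gcongr
            linarith
        _ ≤ 2 * (C * A * x ^ m) := by linarith [show 0 ≤ C * A * x ^ m by positivity]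
        _ = _ := by rw [pow_succ]; field_simp
  have hsum' : Summable fun k : ℤ ↦ C * (2 * x⁻¹) * A * x ^ (k - q).natAbs :=
    ((Equiv.subRight q).summable_iff.2 hsum).mul_left _
  calc ∑' k, dyadicSphereSup (fun x ↦ (g x : ℂ)) k
      ≤ ∑' k : ℤ, ENNReal.ofReal (C * (2 * x⁻¹) * A * x ^ (k - q).natAbs) := ENNReal.tsum_le_tsum hk
    _ = ENNReal.ofReal (∑' k : ℤ, C * (2 * x⁻¹) * A * x ^ (k - q).natAbs) :=
        (ENNReal.ofReal_tsum_of_nonneg (fun k ↦ by positivity) hsum').symm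
    _ = _ := by
        have hshift : ∑' k : ℤ, x ^ (k - q).natAbs = S :=
          (Equiv.subRight q).tsum_eq fun k : ℤ ↦ x ^ k.natAbs
        rw [tsum_mul_left, hshift]
        congr 1
        ring

end DyadicSum

section SingleLevel

variable {V : Type*} [NormedAddCommGroup V] [InnerProductSpace ℝ V] [FiniteDimensional ℝ V]
  [MeasurableSpace V] [BorelSpace V]

/-- The dyadic estimate for a function of amplitude `H` dominated by a power of a `C¹` cutoff `v`
whose total variation is comparable to that of `g / H`. -/
lemma exists_tsum_dyadicSphereSup_le_of_cutoff (hd : 3 ≤ finrank ℝ V) :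
    ∃ C > 0, ∀ (g v : V → ℝ) (H a : ℝ), ContDiff ℝ 1 g → HasCompactSupport g →
      ContDiff ℝ 1 v → HasCompactSupport v → 0 < H → 0 ≤ a → (∀ x, ‖g x‖ ≤ H) →
      (∀ x, g x ≠ 0 → v x = 1) → ∫ x, ‖fderiv ℝ g x‖ ≤ a → ∫ x, ‖fderiv ℝ v x‖ ≤ a / H →
      ∑' k, dyadicSphereSup (fun x ↦ (g x : ℂ)) k ≤ ENNReal.ofReal (C * a) := by
  obtain ⟨C, hC, hE⟩ := exists_tsum_dyadicSphereSup_le_of_single_scale hd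
  set d := finrank ℝ V with hdef
  have hd1 : 1 < (d : ℝ) := by exact_mod_cast (by omega : 1 < d)
  set e : ℝ := ((d - 1 : ℕ) : ℝ)⁻¹ with he
  have hd' : ((d - 1 : ℕ) : ℝ) = d - 1 := by push_cast [show 1 ≤ d by omega]; ring
  have he0 : 0 < e := by rw [he, hd']; exact inv_pos.2 (by linarith)
  set p : ℝ := 1 + e with hp
  have hpd : Real.HolderConjugate d p := by
    rw [Real.holderConjugate_iff]
    refine ⟨hd1, ?_⟩
    have h1 : (d : ℝ) - 1 ≠ 0 := by linarith
    have h2 : (d : ℝ) ≠ 0 := by linarith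
    have h3 : p = d / (d - 1) := by rw [hp, he, hd']; field_simp; ring
    rw [h3, inv_div, sub_div, div_self h2, one_div]
    ring
  set K₀ : ℝ := (lintegralPowLePowLIntegralFDerivConst (volume : Measure V) p : ℝ)
  set K := max K₀ 1
  have hK1 : 1 ≤ K := le_max_right _ _
  have hK0 : K₀ ≤ K := le_max_left _ _
  have hKK : K ≤ K ^ p := by
    simpa using Real.rpow_le_rpow_of_exponent_le hK1 (show 1 ≤ p by linarith)
  refine ⟨C * K, by positivity, fun g v H a hg hgs hv hvs hH ha hgH hgv hga hva ↦ ?_⟩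
  have hgi : Integrable g := hg.continuous.integrable_of_hasCompactSupport hgs
  have hL1 : ∫ x, ‖g x‖ ≤ H * (K * (a / H) ^ p) := by
    have h1 : ∫⁻ x, ‖g x‖ₑ ≤ ENNReal.ofReal (H * (K * (a / H) ^ p)) := by
      calc ∫⁻ x, ‖g x‖ₑ ≤ ∫⁻ x, ENNReal.ofReal H * ‖v x‖ₑ ^ p := by
            refine lintegral_mono fun x ↦ ?_
            by_cases hx : g x = 0
            · simp [hx]
            · simp only [hgv x hx, enorm_one, ENNReal.one_rpow, mul_one]
              rw [← ofReal_norm]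
              exact ENNReal.ofReal_le_ofReal (hgH x)
        _ = ENNReal.ofReal H * ∫⁻ x, ‖v x‖ₑ ^ p := lintegral_const_mul' _ _ ofReal_ne_top
        _ ≤ ENNReal.ofReal H * (lintegralPowLePowLIntegralFDerivConst (volume : Measure V) p
              * (∫⁻ x, ‖fderiv ℝ v x‖ₑ) ^ p) := by
            gcongr
            exact lintegral_pow_le_pow_lintegral_fderiv volume hv hvs hpd
        _ ≤ ENNReal.ofReal H * (ENNReal.ofReal K * ENNReal.ofReal (a / H) ^ p) := by
            gcongr
            · rw [← ENNReal.ofReal_coe_nnreal]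
              exact ENNReal.ofReal_le_ofReal hK0
            · rw [← ofReal_integral_norm_eq_lintegral_enorm
                (integrable_fderiv_of_compactSupport hv hvs)]
              exact ENNReal.ofReal_le_ofReal hva
        _ = _ := by
            rw [ENNReal.ofReal_mul hH.le, ENNReal.ofReal_mul (by positivity),
              ENNReal.ofReal_rpow_of_nonneg (by positivity) (by positivity)]
    rw [← ofReal_integral_norm_eq_lintegral_enorm hgi] at h1
    exact (ENNReal.ofReal_le_ofReal_iff (by positivity)).1 h1
  have key : ∀ A, K * a < A →
      ∑' k, dyadicSphereSup (fun x ↦ (g x : ℂ)) k ≤ ENNReal.ofReal (C * A) := by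
    intro A hA
    have hA0 : 0 < A := lt_of_le_of_lt (by positivity) hA
    have haA : a ≤ A := by nlinarith
    have hRpow : ((H / A) ^ e) ^ (d - 1) = H / A := by
      rw [← Real.rpow_natCast, ← Real.rpow_mul (by positivity), he,
        inv_mul_cancel₀ (by rw [hd']; linarith), Real.rpow_one]
    refine hE g A ((H / A) ^ e) hg hgs (fun x ↦ ?_) (hga.trans haA) (hL1.trans ?_) hA0
      (by positivity)
    · rw [hRpow, mul_div_cancel₀ _ hA0.ne']
      exact hgH x
    · have h2 : A / (H / A) ^ e = H * (A / H) ^ p := by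
        rw [hp, Real.rpow_add (by positivity), Real.rpow_one, ← inv_div A H,
          Real.inv_rpow (by positivity)]
        field_simp
      rw [h2]
      gcongr
      calc K * (a / H) ^ p ≤ K ^ p * (a / H) ^ p := by gcongr
        _ = (K * a / H) ^ p := by
            rw [← Real.mul_rpow (by positivity) (by positivity), mul_div_assoc]
        _ ≤ _ := by gcongr
  have hlim : Filter.Tendsto (fun A ↦ ENNReal.ofReal (C * A)) (nhdsWithin (K * a) (Ioi (K * a)))
      (nhds (ENNReal.ofReal (C * (K * a)))) :=
    ((ENNReal.continuous_ofReal.comp (continuous_const_mul C)).tendsto _).mono_left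
      nhdsWithin_le_nhds
  rw [mul_assoc]
  exact ge_of_tendsto hlim (Filter.eventually_of_mem self_mem_nhdsWithin fun A hA ↦ key A hA)

end SingleLevel

section LevelSets

/-- Smooth functions `ψ`, `χ` on the line used to cut a function into dyadic levels. -/
lemma exists_level_cutoffs :
    ∃ (η ψ χ : ℝ → ℝ) (L : ℝ), 0 < L ∧
      (∀ s, ψ s = s * (η (s / 2) - η s)) ∧ (∀ s, |s| ≤ 1 / 2 → η s = 1) ∧
      (∀ s, 1 ≤ |s| → η s = 0) ∧ (∀ s, |η s| ≤ 1) ∧ Continuous η ∧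
      ContDiff ℝ 1 ψ ∧ ContDiff ℝ 1 χ ∧ (∀ s, |ψ s| ≤ 2) ∧ (∀ s, ψ s ≠ 0 → χ s = 1) ∧ χ 0 = 0 ∧
      (∀ s, |deriv ψ s| ≤ L) ∧ (∀ s, |deriv χ s| ≤ L) ∧
      (∀ s, deriv ψ s ≠ 0 → |s| ∈ Icc (1 / 4) 2) ∧
      (∀ s, deriv χ s ≠ 0 → |s| ∈ Icc (1 / 4) 2) := by
  let η : ContDiffBump (0 : ℝ) := ⟨1 / 2, 1, by norm_num, by norm_num⟩
  have hη1 : ∀ s : ℝ, |s| ≤ 1 / 2 → η s = 1 := fun s hs ↦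
    η.one_of_mem_closedBall (by simpa [η] using hs)
  have hη0 : ∀ s : ℝ, 1 ≤ |s| → η s = 0 := fun s hs ↦
    η.zero_of_le_dist (by simpa [η] using hs)
  have hηs : ContDiff ℝ 1 (η : ℝ → ℝ) := η.contDiff
  set ψ : ℝ → ℝ := fun s ↦ s * (η (s / 2) - η s)
  set χ : ℝ → ℝ := fun s ↦ 1 - η (2 * s)
  have hψs : ContDiff ℝ 1 ψ :=
    contDiff_id.mul ((hηs.comp (contDiff_id.div_const 2)).sub hηs)
  have hχs : ContDiff ℝ 1 χ := contDiff_const.sub (hηs.comp (contDiff_const.mul contDiff_id))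
  have hψlow : ∀ s : ℝ, |s| ≤ 1 / 2 → ψ s = 0 := by
    intro s hs
    have h2 : |s / 2| ≤ 1 / 2 := by rw [abs_div, abs_two]; linarith [abs_nonneg s]
    simp only [ψ, hη1 s hs, hη1 _ h2, sub_self, mul_zero]
  have hψhigh : ∀ s : ℝ, 2 ≤ |s| → ψ s = 0 := by
    intro s hs
    have h2 : 1 ≤ |s / 2| := by rw [abs_div, abs_two]; linarith
    simp only [ψ, hη0 s (by linarith), hη0 _ h2, sub_self, mul_zero]
  have hη01 : ∀ s, 0 ≤ η s ∧ η s ≤ 1 := fun s ↦ ⟨η.nonneg, η.le_one⟩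
  have hψder : ∀ s, deriv ψ s ≠ 0 → |s| ∈ Icc (1 / 4) 2 := by
    intro s hs
    by_contra hcon
    apply hs
    have : ψ =ᶠ[nhds s] fun _ ↦ 0 := by
      rw [mem_Icc, not_and_or, not_le, not_le] at hcon
      rcases hcon with h | h
      · filter_upwards [continuous_abs.continuousAt.eventually_lt_const h] with t ht
        exact hψlow t (by linarith)
      · filter_upwards [continuous_abs.continuousAt.eventually_const_lt h] with t ht
        exact hψhigh t ht.le
    rw [this.deriv_eq, deriv_const]
  have hχder : ∀ s, deriv χ s ≠ 0 → |s| ∈ Icc (1 / 4) 2 := by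
    intro s hs
    by_contra hcon
    apply hs
    have : ∃ c : ℝ, χ =ᶠ[nhds s] fun _ ↦ c := by
      rw [mem_Icc, not_and_or, not_le, not_le] at hcon
      rcases hcon with h | h
      · refine ⟨0, ?_⟩
        filter_upwards [continuous_abs.continuousAt.eventually_lt_const h] with t ht
        simp only [χ]
        rw [hη1 _ (by rw [abs_mul, abs_two]; linarith), sub_self]
      · refine ⟨1, ?_⟩
        filter_upwards [continuous_abs.continuousAt.eventually_const_lt h] with t ht
        simp only [χ]
        rw [hη0 _ (by rw [abs_mul, abs_two]; linarith), sub_zero]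
    obtain ⟨c, hc⟩ := this
    rw [hc.deriv_eq, deriv_const]
  have hbound : ∀ w : ℝ → ℝ, ContDiff ℝ 1 w → (∀ s, deriv w s ≠ 0 → |s| ∈ Icc (1 / 4) 2) →
      ∃ L, ∀ s, |deriv w s| ≤ L := by
    intro w hw hws
    have hcs : HasCompactSupport (deriv w) :=
      HasCompactSupport.of_support_subset_isCompact (isCompact_closedBall (0 : ℝ) 2)
        fun s hs ↦ by simpa using (hws s hs).2
    exact hcs.exists_bound_of_continuous (hw.continuous_deriv le_rfl)
  obtain ⟨L₁, hL₁⟩ := hbound ψ hψs hψder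
  obtain ⟨L₂, hL₂⟩ := hbound χ hχs hχder
  have hL₁0 : 0 ≤ L₁ := (abs_nonneg _).trans (hL₁ 0)
  have hL₂0 : 0 ≤ L₂ := (abs_nonneg _).trans (hL₂ 0)
  refine ⟨η, ψ, χ, L₁ + L₂ + 1, by linarith, fun s ↦ rfl, hη1, hη0, fun s ↦ ?_, hηs.continuous,
    hψs, hχs, fun s ↦ ?_, fun s hs ↦ ?_, ?_, fun s ↦ ?_, fun s ↦ ?_, hψder, hχder⟩
  · rw [abs_of_nonneg (hη01 s).1]; exact (hη01 s).2
  · by_cases hs : 2 ≤ |s|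
    · simp [hψhigh s hs]
    · simp only [ψ, abs_mul]
      have : |η (s / 2) - η s| ≤ 1 := by
        rw [abs_le]
        constructor <;> linarith [hη01 s, hη01 (s / 2), (hη01 s).1, (hη01 s).2, (hη01 (s / 2)).1,
          (hη01 (s / 2)).2]
      nlinarith [abs_nonneg s, abs_nonneg (η (s / 2) - η s)]
  · have h1 : 1 / 2 < |s| := by
      by_contra! h
      exact hs (hψlow s h)
    simp only [χ]
    rw [hη0 _ (by rw [abs_mul, abs_two]; linarith), sub_zero]
  · simp only [χ]
    rw [hη1 _ (by norm_num), sub_self]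
  · linarith [hL₁ s]
  · linarith [hL₂ s]

/-- The dyadic level annuli overlap at most four times. -/
lemma tsum_indicator_level_le (t : ℝ) :
    ∑' m : ℤ, ({s : ℝ | |s| ∈ Icc (1 / 4) 2}.indicator (fun _ ↦ (1 : ℝ≥0∞)) (2 ^ (-m) * t))
      ≤ 4 := by
  by_cases ht : t = 0
  · have : ∀ m : ℤ, ({s : ℝ | |s| ∈ Icc (1 / 4) 2}.indicator (fun _ ↦ (1 : ℝ≥0∞)) (2 ^ (-m) * t))
        = 0 := fun m ↦ by
      apply indicator_of_notMem
      simp [ht]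
    rw [tsum_congr this]
    simp
  obtain ⟨q, hq1, hq2⟩ := exists_mem_Ico_zpow (abs_pos.2 ht) (one_lt_two (α := ℝ))
  rw [tsum_eq_sum (s := Finset.Icc (q - 1) (q + 2))]
  · refine (Finset.sum_le_sum (g := fun _ ↦ (1 : ℝ≥0∞)) fun m _ ↦ ?_).trans ?_
    · rw [indicator_apply]
      split_ifs <;> simp
    · simp [show q + 2 + 1 - (q - 1) = 4 by ring]
  · intro m hm
    apply indicator_of_notMem
    contrapose! hm
    rw [mem_ofPred_eq, abs_mul, abs_of_pos (by positivity), zpow_neg, inv_mul_eq_div] at hm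
    obtain ⟨h1, h2⟩ := hm
    have hp : (0 : ℝ) < 2 ^ m := by positivity
    rw [le_div_iff₀ hp] at h1
    rw [div_le_iff₀ hp] at h2
    rw [Finset.mem_Icc]
    have h3 : (2 : ℝ) ^ q ≤ 2 ^ (m + 1) := by
      rw [zpow_add_one₀ two_ne_zero]; linarith
    have h4 : (2 : ℝ) ^ (m - 2) < 2 ^ (q + 1) := by
      refine lt_of_le_of_lt ?_ hq2
      rw [zpow_sub₀ two_ne_zero]
      norm_num
      linarith
    have h5 := (zpow_le_zpow_iff_right₀ (one_lt_two (α := ℝ))).1 h3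
    have h6 := (zpow_lt_zpow_iff_right₀ (one_lt_two (α := ℝ))).1 h4
    omega

end LevelSets

section CompactlySupported

variable {V : Type*} [NormedAddCommGroup V] [InnerProductSpace ℝ V] [FiniteDimensional ℝ V]
  [MeasurableSpace V] [BorelSpace V]

lemma fourier_finsetSum {ι : Type*} (s : Finset ι) {F : ι → V → ℂ} (hF : ∀ i, Integrable (F i))
    (ξ : V) : 𝓕 (fun x ↦ ∑ i ∈ s, F i x) ξ = ∑ i ∈ s, 𝓕 (F i) ξ := by
  simp only [Real.fourier_eq, Finset.smul_sum]
  exact integral_finsetSum _ fun i _ ↦ (Real.fourierIntegral_convergent_iff ξ).2 (hF i)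

/-- Subadditivity of the dyadic suprema under pointwise domination of Fourier transforms. -/
lemma dyadicSphereSup_le_tsum {ι : Type*} [Countable ι] {F : V → ℂ} {G : ι → V → ℂ}
    (hG : ∀ i, Integrable (G i)) (h : ∀ ξ, ‖𝓕 F ξ‖ₑ ≤ ∑' i, ‖𝓕 (G i) ξ‖ₑ) (k : ℤ) :
    dyadicSphereSup F k ≤ ∑' i, dyadicSphereSup (G i) k := by
  refine iSup₂_le fun r hr ↦ ?_
  have hm : ∀ i, Measurable fun θ ↦ ‖𝓕 (G i) (r • θ)‖ₑ := fun i ↦ by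
    have hc := continuous_fourierWith (hG i)
    rw [fourierWith_volume] at hc
    exact (continuous_enorm.comp (hc.comp (continuous_const_smul r))).measurable
  calc ENNReal.ofReal r * ∫⁻ θ, ‖𝓕 F (r • θ)‖ₑ ∂(sphereMeasure V)
      ≤ ENNReal.ofReal r * ∫⁻ θ, ∑' i, ‖𝓕 (G i) (r • θ)‖ₑ ∂(sphereMeasure V) := by
        gcongr with θ
        exact h _
    _ = ∑' i, ENNReal.ofReal r * ∫⁻ θ, ‖𝓕 (G i) (r • θ)‖ₑ ∂(sphereMeasure V) := by
        rw [lintegral_tsum fun i ↦ (hm i).aemeasurable, ENNReal.tsum_mul_left]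
    _ ≤ _ := ENNReal.tsum_le_tsum fun i ↦ le_iSup₂_of_le r hr le_rfl

/-- Telescoping over dyadic levels. -/
lemma sum_range_dyadic_levels {η ψ : ℝ → ℝ} (hψ : ∀ s, ψ s = s * (η (s / 2) - η s)) (t : ℝ)
    (M : ℕ) :
    ∑ i ∈ Finset.range (2 * M), (2 : ℝ) ^ ((i : ℤ) - M) * ψ (2 ^ (-((i : ℤ) - M)) * t)
      = t * (η (2 ^ (-(M : ℤ)) * t) - η (2 ^ (M : ℤ) * t)) := by
  have h : ∀ i : ℕ, (2 : ℝ) ^ ((i : ℤ) - M) * ψ (2 ^ (-((i : ℤ) - M)) * t)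
      = t * η (2 ^ (-(((i + 1 : ℕ) : ℤ) - M)) * t) - t * η (2 ^ (-((i : ℤ) - M)) * t) := by
    intro i
    have h1 : (2 : ℝ) ^ (-(((i + 1 : ℕ) : ℤ) - M)) * t = 2 ^ (-((i : ℤ) - M)) * t / 2 := by
      rw [show -(((i + 1 : ℕ) : ℤ) - M) = -((i : ℤ) - M) - 1 by push_cast; ring,
        zpow_sub_one₀ two_ne_zero]
      ring
    have h2 : (2 : ℝ) ^ ((i : ℤ) - M) * 2 ^ (-((i : ℤ) - M)) = 1 := by
      rw [← zpow_add₀ two_ne_zero, add_neg_cancel, zpow_zero]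
    rw [h1, hψ, ← mul_assoc, ← mul_assoc, h2]
    ring
  rw [Finset.sum_congr rfl fun i _ ↦ h i,
    Finset.sum_range_sub fun i : ℕ ↦ t * η (2 ^ (-((i : ℤ) - M)) * t)]
  have h3 : -(((2 * M : ℕ) : ℤ) - M) = -(M : ℤ) := by push_cast; ring
  have h4 : -(((0 : ℕ) : ℤ) - M) = (M : ℤ) := by simp
  rw [h3, h4]
  ring

lemma tendsto_dyadic_levels {η : ℝ → ℝ} (hη1 : ∀ s, |s| ≤ 1 / 2 → η s = 1)
    (hη0 : ∀ s, 1 ≤ |s| → η s = 0) (t : ℝ) :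
    Filter.Tendsto (fun M : ℕ ↦ t * (η (2 ^ (-(M : ℤ)) * t) - η (2 ^ (M : ℤ) * t))) Filter.atTop
      (nhds t) := by
  by_cases ht : t = 0
  · simp [ht]
  apply tendsto_const_nhds.congr'
  have hpow : Filter.Tendsto (fun M : ℕ ↦ (2 : ℝ) ^ M) Filter.atTop Filter.atTop :=
    tendsto_pow_atTop_atTop_of_one_lt one_lt_two
  filter_upwards [hpow.eventually_ge_atTop (2 * |t|), hpow.eventually_ge_atTop |t|⁻¹] with M h1 h2
  have hM : (0 : ℝ) < 2 ^ M := by positivity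
  have ht' : 0 < |t| := abs_pos.2 ht
  rw [hη1, hη0]
  · ring
  · rw [zpow_natCast, abs_mul, abs_of_pos hM]
    rwa [inv_le_iff_one_le_mul₀ ht'] at h2
  · rw [zpow_neg, zpow_natCast, abs_mul, abs_of_pos (by positivity), inv_mul_eq_div,
      div_le_iff₀ hM]
    linarith

lemma enorm_fourier_le_tsum_levels {η ψ : ℝ → ℝ} (hψ : ∀ s, ψ s = s * (η (s / 2) - η s))
    (hη1 : ∀ s, |s| ≤ 1 / 2 → η s = 1) (hη0 : ∀ s, 1 ≤ |s| → η s = 0) (hη : ∀ s, |η s| ≤ 1)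
    {f : V → ℝ} (hf : Integrable f)
    (hi : ∀ m : ℤ, Integrable fun x ↦ ((2 ^ m * ψ (2 ^ (-m) * f x) : ℝ) : ℂ)) (ξ : V) :
    ‖𝓕 (fun x ↦ (f x : ℂ)) ξ‖ₑ
      ≤ ∑' m : ℤ, ‖𝓕 (fun x ↦ ((2 ^ m * ψ (2 ^ (-m) * f x) : ℝ) : ℂ)) ξ‖ₑ := by
  set G : ℤ → V → ℂ := fun m x ↦ ((2 ^ m * ψ (2 ^ (-m) * f x) : ℝ) : ℂ)
  have hsum : ∀ (M : ℕ) (x : V), ∑ i ∈ Finset.range (2 * M), G ((i : ℤ) - M) x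
      = ((f x * (η (2 ^ (-(M : ℤ)) * f x) - η (2 ^ (M : ℤ) * f x)) : ℝ) : ℂ) := by
    intro M x
    rw [← sum_range_dyadic_levels hψ, Complex.ofReal_sum]
  have hlim : Filter.Tendsto (fun M : ℕ ↦ ∑ i ∈ Finset.range (2 * M), 𝓕 (G ((i : ℤ) - M)) ξ)
      Filter.atTop (nhds (𝓕 (fun x ↦ (f x : ℂ)) ξ)) := by
    have h1 : ∀ M : ℕ, ∑ i ∈ Finset.range (2 * M), 𝓕 (G ((i : ℤ) - M)) ξ
        = ∫ x, 𝐞 (-⟪x, ξ⟫) • ∑ i ∈ Finset.range (2 * M), G ((i : ℤ) - M) x := by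
      intro M
      rw [← fourier_finsetSum _ (fun i : ℕ ↦ hi ((i : ℤ) - M)), Real.fourier_eq]
    simp only [h1]
    rw [Real.fourier_eq]
    refine tendsto_integral_of_dominated_convergence (fun x ↦ 2 * ‖f x‖) (fun M ↦ ?_)
      (hf.norm.const_mul 2) (fun M ↦ ae_of_all _ fun x ↦ ?_) (ae_of_all _ fun x ↦ ?_)
    · exact ((Real.fourierIntegral_convergent_iff ξ).2
        (integrable_finsetSum _ fun (i : ℕ) _ ↦ hi ((i : ℤ) - M))).1
    · rw [Circle.norm_smul, hsum, Complex.norm_real, norm_mul, mul_comm]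
      gcongr
      refine (norm_sub_le _ _).trans ?_
      rw [Real.norm_eq_abs, Real.norm_eq_abs]
      linarith [hη (2 ^ (-(M : ℤ)) * f x), hη (2 ^ (M : ℤ) * f x)]
    · simp only [hsum]
      exact ((Complex.continuous_ofReal.tendsto _).comp
        (tendsto_dyadic_levels hη1 hη0 (f x))).const_smul _
  refine le_of_tendsto' hlim.enorm fun M ↦ ?_
  refine (enorm_sum_le _ _).trans ?_
  have hinj : Function.Injective fun i : ℕ ↦ (i : ℤ) - M := fun i j hij ↦ by
    simpa using hij
  calc ∑ i ∈ Finset.range (2 * M), ‖𝓕 (G ((i : ℤ) - M)) ξ‖ₑ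
      = ∑ m ∈ (Finset.range (2 * M)).map ⟨_, hinj⟩, ‖𝓕 (G m) ξ‖ₑ := by
        rw [Finset.sum_map]; rfl
    _ ≤ _ := ENNReal.sum_le_tsum _

lemma norm_fderiv_comp_level_le {w : ℝ → ℝ} (hw : ContDiff ℝ 1 w) {L : ℝ}
    (hL : ∀ s, |deriv w s| ≤ L) (hws : ∀ s, deriv w s ≠ 0 → |s| ∈ Icc (1 / 4) 2)
    {f : V → ℝ} (hf : ContDiff ℝ 1 f) (c : ℝ) (x : V) :
    ‖fderiv ℝ (fun x ↦ w (c * f x)) x‖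
      ≤ L * |c| * {x | |c * f x| ∈ Icc (1 / 4) 2}.indicator (fun x ↦ ‖fderiv ℝ f x‖) x := by
  have h1 : HasFDerivAt (fun x ↦ c * f x) (c • fderiv ℝ f x) x :=
    (hf.differentiable one_ne_zero x).hasFDerivAt.const_mul c
  have h2 := ((hw.differentiable one_ne_zero (c * f x)).hasDerivAt).comp_hasFDerivAt x h1
  have h3 : fderiv ℝ (fun x ↦ w (c * f x)) x = deriv w (c * f x) • c • fderiv ℝ f x := h2.fderiv
  rw [h3, norm_smul, norm_smul, Real.norm_eq_abs, Real.norm_eq_abs]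
  by_cases hx : x ∈ {x | |c * f x| ∈ Icc (1 / 4) 2}
  · rw [indicator_of_mem hx, mul_assoc]
    gcongr
    exact hL _
  · rw [indicator_of_notMem hx]
    have : deriv w (c * f x) = 0 := by
      by_contra hne
      exact hx (hws _ hne)
    simp [this]

/-- The dyadic estimate for compactly supported `C¹` functions. -/
lemma exists_tsum_dyadicSphereSup_le (hd : 3 ≤ finrank ℝ V) :
    ∃ C > 0, ∀ f : V → ℝ, ContDiff ℝ 1 f → HasCompactSupport f →
      ∑' k, dyadicSphereSup (fun x ↦ (f x : ℂ)) k
        ≤ ENNReal.ofReal C * ∫⁻ x, ‖fderiv ℝ f x‖ₑ := by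
  obtain ⟨C, hC, hcut⟩ := exists_tsum_dyadicSphereSup_le_of_cutoff hd
  obtain ⟨η, ψ, χ, L, hL, hψ, hη1, hη0, hη, hηc, hψs, hχs, hψ2, hψχ, hχ0, hψL, hχL, hψd, hχd⟩ :=
    exists_level_cutoffs
  have hψ0 : ψ 0 = 0 := by simp [hψ]
  refine ⟨C * (2 * L) * 4, by positivity, fun f hf hfs ↦ ?_⟩
  have hfi : Integrable f := hf.continuous.integrable_of_hasCompactSupport hfs
  set S : ℤ → Set V := fun m ↦ {x | |2 ^ (-m) * f x| ∈ Icc (1 / 4) 2}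
  have hSm : ∀ m, MeasurableSet (S m) := fun m ↦
    measurableSet_Icc.preimage
      (by have := hf.continuous; fun_prop : Continuous fun x ↦ |2 ^ (-m) * f x|).measurable
  have hdi := integrable_fderiv_of_compactSupport hf hfs
  have hgs : ∀ m : ℤ, HasCompactSupport fun x ↦ 2 ^ m * ψ (2 ^ (-m) * f x) := fun m ↦
    hfs.comp_left (g := fun t ↦ 2 ^ m * ψ (2 ^ (-m) * t)) (by simp [hψ0])
  have hvs : ∀ m : ℤ, HasCompactSupport fun x ↦ χ (2 ^ (-m) * f x) := fun m ↦
    hfs.comp_left (g := fun t ↦ χ (2 ^ (-m) * t)) (by simp [hχ0])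
  have hgc : ∀ m : ℤ, ContDiff ℝ 1 fun x ↦ 2 ^ m * ψ (2 ^ (-m) * f x) := fun m ↦
    contDiff_const.mul (hψs.comp (contDiff_const.mul hf))
  have hvc : ∀ m : ℤ, ContDiff ℝ 1 fun x ↦ χ (2 ^ (-m) * f x) := fun m ↦
    hχs.comp (contDiff_const.mul hf)
  have hgi : ∀ m : ℤ, Integrable fun x ↦ ((2 ^ m * ψ (2 ^ (-m) * f x) : ℝ) : ℂ) := fun m ↦
    ((hgc m).continuous.integrable_of_hasCompactSupport (hgs m)).ofReal
  have hlevel : ∀ m : ℤ,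
      ∑' k, dyadicSphereSup (fun x ↦ ((2 ^ m * ψ (2 ^ (-m) * f x) : ℝ) : ℂ)) k
        ≤ ENNReal.ofReal (C * (2 * L)) * ∫⁻ x in S m, ‖fderiv ℝ f x‖ₑ := by
    intro m
    have hp : (0 : ℝ) < 2 ^ m := by positivity
    set I := ∫ x in S m, ‖fderiv ℝ f x‖
    have hI : 0 ≤ I := integral_nonneg fun x ↦ norm_nonneg _
    have hind : Integrable ((S m).indicator fun x ↦ ‖fderiv ℝ f x‖) := hdi.norm.indicator (hSm m)
    have hder : ∀ w : ℝ → ℝ, ContDiff ℝ 1 w → (∀ s, |deriv w s| ≤ L) →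
        (∀ s, deriv w s ≠ 0 → |s| ∈ Icc (1 / 4) 2) →
        ∫ x, ‖fderiv ℝ (fun x ↦ w (2 ^ (-m) * f x)) x‖ ≤ L * 2 ^ (-m) * I := by
      intro w hw hwL hwd
      have h1 : ∫ x, ‖fderiv ℝ (fun x ↦ w (2 ^ (-m) * f x)) x‖
          ≤ ∫ x, L * 2 ^ (-m) * (S m).indicator (fun x ↦ ‖fderiv ℝ f x‖) x := by
        refine integral_mono_of_nonneg (ae_of_all _ fun x ↦ norm_nonneg _) (hind.const_mul _)
          (ae_of_all _ fun x ↦ ?_)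
        have := norm_fderiv_comp_level_le hw hwL hwd hf (2 ^ (-m)) x
        rwa [abs_of_pos (by positivity)] at this
      rwa [integral_const_mul, integral_indicator (hSm m)] at h1
    have h := hcut (fun x ↦ 2 ^ m * ψ (2 ^ (-m) * f x)) (fun x ↦ χ (2 ^ (-m) * f x)) (2 * 2 ^ m)
      (2 * L * I) (hgc m) (hgs m) (hvc m) (hvs m) (by positivity) (by positivity)
      (fun x ↦ by
        rw [norm_mul, Real.norm_eq_abs, Real.norm_eq_abs, abs_of_pos hp, mul_comm]
        gcongr
        exact hψ2 _)
      (fun x hx ↦ hψχ _ (right_ne_zero_of_mul hx))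
      (by
        have hψdiff : ∀ x, DifferentiableAt ℝ (fun x ↦ ψ (2 ^ (-m) * f x)) x := fun x ↦
          (hψs.comp (contDiff_const.mul hf)).differentiable one_ne_zero x
        have h1 : ∀ x, ‖fderiv ℝ (fun x ↦ 2 ^ m * ψ (2 ^ (-m) * f x)) x‖
            = 2 ^ m * ‖fderiv ℝ (fun x ↦ ψ (2 ^ (-m) * f x)) x‖ := fun x ↦ by
          rw [fderiv_const_mul (hψdiff x), norm_smul, Real.norm_eq_abs, abs_of_pos hp]
        simp only [h1]
        rw [integral_const_mul]
        calc (2 : ℝ) ^ m * ∫ x, ‖fderiv ℝ (fun x ↦ ψ (2 ^ (-m) * f x)) x‖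
            ≤ 2 ^ m * (L * 2 ^ (-m) * I) := by
              gcongr
              exact hder ψ hψs hψL hψd
          _ = L * I := by rw [zpow_neg]; field_simp
          _ ≤ _ := by nlinarith [mul_nonneg hL.le hI])
      ((hder χ hχs hχL hχd).trans_eq (by rw [zpow_neg]; field_simp))
    refine h.trans_eq ?_
    rw [← mul_assoc, ENNReal.ofReal_mul (by positivity),
      ofReal_integral_norm_eq_lintegral_enorm hdi.integrableOn]
  calc ∑' k, dyadicSphereSup (fun x ↦ (f x : ℂ)) k
      ≤ ∑' k, ∑' m : ℤ, dyadicSphereSup (fun x ↦ ((2 ^ m * ψ (2 ^ (-m) * f x) : ℝ) : ℂ)) k :=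
        ENNReal.tsum_le_tsum fun k ↦ dyadicSphereSup_le_tsum hgi
          (enorm_fourier_le_tsum_levels hψ hη1 hη0 hη hfi hgi) k
    _ = ∑' m : ℤ, ∑' k, dyadicSphereSup (fun x ↦ ((2 ^ m * ψ (2 ^ (-m) * f x) : ℝ) : ℂ)) k :=
        ENNReal.tsum_comm
    _ ≤ ∑' m : ℤ, ENNReal.ofReal (C * (2 * L)) * ∫⁻ x in S m, ‖fderiv ℝ f x‖ₑ :=
        ENNReal.tsum_le_tsum hlevel
    _ = ENNReal.ofReal (C * (2 * L)) * ∑' m : ℤ, ∫⁻ x in S m, ‖fderiv ℝ f x‖ₑ :=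
        ENNReal.tsum_mul_left
    _ ≤ ENNReal.ofReal (C * (2 * L)) * (4 * ∫⁻ x, ‖fderiv ℝ f x‖ₑ) := by
        gcongr
        have hme : Measurable fun x ↦ ‖fderiv ℝ f x‖ₑ :=
          (continuous_enorm.comp (hf.continuous_fderiv one_ne_zero)).measurable
        calc ∑' m : ℤ, ∫⁻ x in S m, ‖fderiv ℝ f x‖ₑ
            = ∫⁻ x, ∑' m : ℤ, (S m).indicator (fun x ↦ ‖fderiv ℝ f x‖ₑ) x := by
              rw [lintegral_tsum fun m ↦ (hme.indicator (hSm m)).aemeasurable]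
              exact tsum_congr fun m ↦ (lintegral_indicator (hSm m) _).symm
          _ ≤ ∫⁻ x, 4 * ‖fderiv ℝ f x‖ₑ := by
              refine lintegral_mono fun x ↦ ?_
              calc ∑' m : ℤ, (S m).indicator (fun x ↦ ‖fderiv ℝ f x‖ₑ) x
                  = ∑' m : ℤ, ({s : ℝ | |s| ∈ Icc (1 / 4) 2}.indicator (fun _ ↦ (1 : ℝ≥0∞))
                      (2 ^ (-m) * f x)) * ‖fderiv ℝ f x‖ₑ := by
                    refine tsum_congr fun m ↦ ?_
                    by_cases hx : x ∈ S m
                    · rw [indicator_of_mem hx, indicator_of_mem (by exact hx), one_mul]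
                    · rw [indicator_of_notMem hx, indicator_of_notMem (by exact hx), zero_mul]
                _ ≤ _ := by
                    rw [ENNReal.tsum_mul_right]
                    gcongr
                    exact tsum_indicator_level_le _
          _ = _ := lintegral_const_mul _ hme
    _ = _ := by
        rw [← mul_assoc, ENNReal.ofReal_mul (p := C * (2 * L)) (by positivity)]
        norm_num

end CompactlySupported

section Approximation

variable {V : Type*} [NormedAddCommGroup V] [InnerProductSpace ℝ V] [FiniteDimensional ℝ V]
  [MeasurableSpace V] [BorelSpace V]

/-- Lower semicontinuity of the dyadic sum under pointwise convergence of Fourier transforms. -/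
lemma tsum_dyadicSphereSup_le_of_tendsto {F : V → ℂ} {G : ℕ → V → ℂ} (hG : ∀ j, Integrable (G j))
    (hlim : ∀ ξ, Filter.Tendsto (fun j ↦ 𝓕 (G j) ξ) Filter.atTop (nhds (𝓕 F ξ)))
    {B : ℕ → ℝ≥0∞} {b : ℝ≥0∞} (hB : ∀ j, ∑' k, dyadicSphereSup (G j) k ≤ B j)
    (hb : Filter.Tendsto B Filter.atTop (nhds b)) :
    ∑' k, dyadicSphereSup F k ≤ b := by
  have hk : ∀ k, dyadicSphereSup F k
      ≤ Filter.liminf (fun j ↦ dyadicSphereSup (G j) k) Filter.atTop := by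
    intro k
    refine iSup₂_le fun r hr ↦ ?_
    have hm : ∀ j, Measurable fun θ ↦ ENNReal.ofReal r * ‖𝓕 (G j) (r • θ)‖ₑ := fun j ↦ by
      have hc := continuous_fourierWith (hG j)
      rw [fourierWith_volume] at hc
      exact (continuous_enorm.comp (hc.comp (continuous_const_smul r))).measurable.const_mul _
    have hF : ∀ θ, ENNReal.ofReal r * ‖𝓕 F (r • θ)‖ₑ
        = Filter.liminf (fun j ↦ ENNReal.ofReal r * ‖𝓕 (G j) (r • θ)‖ₑ) Filter.atTop := fun θ ↦
      (ENNReal.Tendsto.const_mul (hlim (r • θ)).enorm (Or.inr ofReal_ne_top)).liminf_eq.symm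
    calc ENNReal.ofReal r * ∫⁻ θ, ‖𝓕 F (r • θ)‖ₑ ∂(sphereMeasure V)
        = ∫⁻ θ, ENNReal.ofReal r * ‖𝓕 F (r • θ)‖ₑ ∂(sphereMeasure V) :=
          (lintegral_const_mul' _ _ ofReal_ne_top).symm
      _ ≤ Filter.liminf (fun j ↦ ∫⁻ θ, ENNReal.ofReal r * ‖𝓕 (G j) (r • θ)‖ₑ ∂(sphereMeasure V))
            Filter.atTop := by
          simp only [hF]
          exact lintegral_liminf_le hm
      _ ≤ _ := by
          refine Filter.liminf_le_liminf (Filter.Eventually.of_forall fun j ↦ ?_)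
          rw [lintegral_const_mul' _ _ ofReal_ne_top]
          exact le_iSup₂_of_le (f := fun (r : ℝ) (_ : r ∈ Icc ((2 : ℝ) ^ k) ((2 : ℝ) ^ (k + 1))) ↦
            ENNReal.ofReal r * ∫⁻ θ, ‖𝓕 (G j) (r • θ)‖ₑ ∂(sphereMeasure V)) r hr le_rfl
  calc ∑' k, dyadicSphereSup F k
      ≤ ∑' k, Filter.liminf (fun j ↦ dyadicSphereSup (G j) k) Filter.atTop :=
        ENNReal.tsum_le_tsum hk
    _ = ∫⁻ k : ℤ, Filter.liminf (fun j ↦ dyadicSphereSup (G j) k) Filter.atTop ∂Measure.count :=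
        (lintegral_count _).symm
    _ ≤ Filter.liminf (fun j ↦ ∫⁻ k : ℤ, dyadicSphereSup (G j) k ∂Measure.count) Filter.atTop :=
        lintegral_liminf_le fun j ↦ measurable_from_top
    _ ≤ Filter.liminf B Filter.atTop := by
        refine Filter.liminf_le_liminf (Filter.Eventually.of_forall fun j ↦ ?_)
        rw [lintegral_count]
        exact hB j
    _ = b := hb.liminf_eq

lemma norm_fderiv_cutoff_mul_le {θ h : V → ℝ} (hθ : ContDiff ℝ 1 θ) (hh : ContDiff ℝ 1 h)
    (hθ1 : ∀ x, |θ x| ≤ 1) {L : ℝ} (hL : ∀ x, ‖fderiv ℝ θ x‖ ≤ L) {c : ℝ} (hc : 0 ≤ c) (x : V) :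
    ‖fderiv ℝ (fun x ↦ θ (c • x) * h x) x‖ ≤ ‖fderiv ℝ h x‖ + c * L * ‖h x‖ := by
  have h1 : HasFDerivAt (fun x : V ↦ c • x) (c • ContinuousLinearMap.id ℝ V) x :=
    (hasFDerivAt_id x).const_smul c
  have h2 := (hθ.differentiable one_ne_zero (c • x)).hasFDerivAt.comp x h1
  have h3 := h2.mul (hh.differentiable one_ne_zero x).hasFDerivAt
  have h4 : fderiv ℝ (fun x ↦ θ (c • x) * h x) x = θ (c • x) • fderiv ℝ h x
      + h x • (fderiv ℝ θ (c • x)).comp (c • ContinuousLinearMap.id ℝ V) := h3.fderiv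
  rw [h4, ContinuousLinearMap.comp_smul, ContinuousLinearMap.comp_id]
  refine (norm_add_le _ _).trans ?_
  rw [norm_smul, norm_smul, norm_smul, Real.norm_eq_abs c, abs_of_nonneg hc]
  refine add_le_add (mul_le_of_le_one_left (norm_nonneg _) (hθ1 _)) ?_
  rw [mul_comm]
  exact mul_le_mul_of_nonneg_right (mul_le_mul_of_nonneg_left (hL _) hc) (norm_nonneg _)

/-- The dyadic estimate for integrable `C¹` functions. -/
lemma exists_tsum_dyadicSphereSup_le_of_integrable (hd : 3 ≤ finrank ℝ V) :
    ∃ C > 0, ∀ f : V → ℝ, ContDiff ℝ 1 f → Integrable f →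
      ∑' k, dyadicSphereSup (fun x ↦ (f x : ℂ)) k
        ≤ ENNReal.ofReal C * ∫⁻ x, ‖fderiv ℝ f x‖ₑ := by
  obtain ⟨C, hC, hcs⟩ := exists_tsum_dyadicSphereSup_le hd
  refine ⟨C, hC, fun f hf hfi ↦ ?_⟩
  let θ : ContDiffBump (0 : V) := ⟨1, 2, by norm_num, by norm_num⟩
  have hθs : ContDiff ℝ 1 (θ : V → ℝ) := θ.contDiff
  have hθ1 : ∀ x, |θ x| ≤ 1 := fun x ↦ by rw [abs_of_nonneg θ.nonneg]; exact θ.le_one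
  obtain ⟨L, hL⟩ := (θ.hasCompactSupport.fderiv ℝ).exists_bound_of_continuous
    (hθs.continuous_fderiv one_ne_zero)
  have hL0 : 0 ≤ L := (norm_nonneg _).trans (hL 0)
  set c : ℕ → ℝ := fun j ↦ 1 / ((j : ℝ) + 1)
  have hc0 : ∀ j, 0 < c j := fun j ↦ by positivity
  have hclim : Filter.Tendsto c Filter.atTop (nhds 0) := tendsto_one_div_add_atTop_nhds_zero_nat
  set G : ℕ → V → ℝ := fun j x ↦ θ (c j • x) * f x
  have hGc : ∀ j, ContDiff ℝ 1 (G j) := fun j ↦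
    (hθs.comp (contDiff_const_smul (c j))).mul hf
  have hGs : ∀ j, HasCompactSupport (G j) := fun j ↦
    (θ.hasCompactSupport.comp_smul (hc0 j).ne').mul_right
  have hGi : ∀ j, Integrable (G j) := fun j ↦
    (hGc j).continuous.integrable_of_hasCompactSupport (hGs j)
  refine tsum_dyadicSphereSup_le_of_tendsto (G := fun j x ↦ (G j x : ℂ))
    (B := fun j ↦ ENNReal.ofReal C *
      ((∫⁻ x, ‖fderiv ℝ f x‖ₑ) + ENNReal.ofReal (c j * L) * ∫⁻ x, ‖f x‖ₑ))
    (fun j ↦ (hGi j).ofReal) (fun ξ ↦ ?_) (fun j ↦ ?_) ?_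
  · simp only [Real.fourier_eq]
    refine tendsto_integral_of_dominated_convergence (fun x ↦ ‖f x‖) (fun j ↦ ?_) hfi.norm
      (fun j ↦ ae_of_all _ fun x ↦ ?_) (ae_of_all _ fun x ↦ ?_)
    · exact ((Real.fourierIntegral_convergent_iff ξ).2 (hGi j).ofReal).1
    · rw [Circle.norm_smul, Complex.norm_real]
      simp only [G, norm_mul]
      exact mul_le_of_le_one_left (norm_nonneg _) (hθ1 _)
    · refine Filter.Tendsto.const_smul ((Complex.continuous_ofReal.tendsto _).comp ?_) _
      have h1 : Filter.Tendsto (fun j ↦ θ (c j • x)) Filter.atTop (nhds (θ 0)) := by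
        refine (hθs.continuous.tendsto 0).comp ?_
        simpa using hclim.smul_const x
      have h2 : θ (0 : V) = 1 := θ.one_of_mem_closedBall (by simp [θ])
      rw [h2] at h1
      simpa [G] using h1.mul_const (f x)
  · refine (hcs (G j) (hGc j) (hGs j)).trans ?_
    refine mul_le_mul_right ?_ _
    have hcL : 0 ≤ c j * L := mul_nonneg (hc0 j).le hL0
    have hfm : AEMeasurable fun x ↦ ‖fderiv ℝ f x‖ₑ :=
      (continuous_enorm.comp (hf.continuous_fderiv one_ne_zero)).measurable.aemeasurable
    rw [← lintegral_const_mul' _ _ ofReal_ne_top, ← lintegral_add_left' hfm]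
    refine lintegral_mono fun x ↦ ?_
    rw [← ofReal_norm, ← ofReal_norm, ← ofReal_norm, ← ENNReal.ofReal_mul hcL,
      ← ENNReal.ofReal_add (norm_nonneg _) (mul_nonneg hcL (norm_nonneg _))]
    exact ENNReal.ofReal_le_ofReal (norm_fderiv_cutoff_mul_le hθs hf hθ1 hL (hc0 j).le x)
  · refine ENNReal.Tendsto.const_mul ?_ (Or.inr ofReal_ne_top)
    have h1 : Filter.Tendsto (fun j ↦ ENNReal.ofReal (c j * L)) Filter.atTop (nhds 0) := by
      simpa using ENNReal.tendsto_ofReal (hclim.mul_const L)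
    simpa using (ENNReal.Tendsto.mul_const h1 (Or.inr hfi.2.ne)).const_add
      (∫⁻ x, ‖fderiv ℝ f x‖ₑ)

end Approximation

section Mollification

variable {V : Type*} [NormedAddCommGroup V] [InnerProductSpace ℝ V] [FiniteDimensional ℝ V]
  [MeasurableSpace V] [BorelSpace V]

/-- Convolution with a normed bump function does not increase the `L¹` norm. -/
lemma lintegral_enorm_convolution_normed_le {g : V → ℝ} (hg : Integrable g)
    (φ : ContDiffBump (0 : V)) :
    ∫⁻ x, ‖convolution g (φ.normed volume) (ContinuousLinearMap.mul ℝ ℝ) volume x‖ₑ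
      ≤ ∫⁻ x, ‖g x‖ₑ := by
  have hφm : Measurable (φ.normed (volume : Measure V)) := φ.continuous_normed.measurable
  have hφ1 : ∫⁻ x, ‖φ.normed (volume : Measure V) x‖ₑ = 1 := by
    have h := ofReal_integral_eq_lintegral_ofReal (φ.integrable_normed (μ := (volume : Measure V)))
      (ae_of_all _ φ.nonneg_normed)
    rw [φ.integral_normed, ENNReal.ofReal_one] at h
    rw [h]
    refine lintegral_congr fun x ↦ ?_
    rw [Real.enorm_eq_ofReal (φ.nonneg_normed x)]
  calc ∫⁻ x, ‖convolution g (φ.normed volume) (ContinuousLinearMap.mul ℝ ℝ) volume x‖ₑ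
      ≤ ∫⁻ x, ∫⁻ t, ‖g t‖ₑ * ‖φ.normed volume (x - t)‖ₑ := by
        refine lintegral_mono fun x ↦ (enorm_integral_le_lintegral_enorm _).trans ?_
        simp [enorm_mul]
    _ = ∫⁻ t, ∫⁻ x, ‖g t‖ₑ * ‖φ.normed volume (x - t)‖ₑ := by
        refine lintegral_lintegral_swap ?_
        exact (hg.1.enorm.comp_quasiMeasurePreserving
          Measure.quasiMeasurePreserving_snd).mul
          (hφm.enorm.comp (measurable_fst.sub measurable_snd)).aemeasurable
    _ = ∫⁻ t, ‖g t‖ₑ := by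
        refine lintegral_congr fun t ↦ ?_
        rw [lintegral_const_mul' _ _ enorm_ne_top,
          lintegral_sub_right_eq_self (fun x ↦ ‖φ.normed volume x‖ₑ) t, hφ1, mul_one]

lemma fourier_convolution_normed {f : V → ℝ} (hf : Integrable f) (φ : ContDiffBump (0 : V))
    (ξ : V) :
    𝓕 (fun x ↦ ((convolution f (φ.normed volume) (ContinuousLinearMap.mul ℝ ℝ) volume x : ℝ) : ℂ)) ξ
      = 𝓕 (fun x ↦ (f x : ℂ)) ξ * 𝓕 (fun x ↦ (φ.normed volume x : ℂ)) ξ := by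
  refine Eq.trans ?_ (Real.fourier_mul_convolution_eq (f₁ := fun x ↦ (f x : ℂ))
    (f₂ := fun x ↦ (φ.normed volume x : ℂ)) hf.ofReal φ.integrable_normed.ofReal ξ)
  refine congrArg (fun F : V → ℂ ↦ 𝓕 F ξ) (funext fun x ↦ ?_)
  simp only [convolution_def, ContinuousLinearMap.mul_apply']
  rw [← integral_complex_ofReal]
  simp

lemma tendsto_fourier_normed {φ : ℕ → ContDiffBump (0 : V)}
    (hφ : Filter.Tendsto (fun j ↦ (φ j).rOut) Filter.atTop (nhds 0)) (ξ : V) :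
    Filter.Tendsto (fun j ↦ 𝓕 (fun x ↦ ((φ j).normed volume x : ℂ)) ξ) Filter.atTop (nhds 1) := by
  have hg : Continuous fun y : V ↦ (𝐞 ⟪y, ξ⟫ : ℂ) :=
    continuous_subtype_val.comp (Real.continuous_fourierChar.comp (by fun_prop))
  have h := ContDiffBump.convolution_tendsto_right_of_continuous (μ := (volume : Measure V)) hφ hg 0
  simp only [inner_zero_left, AddChar.map_zero_eq_one, Circle.coe_one] at h
  refine h.congr fun j ↦ ?_
  rw [Real.fourier_eq, convolution_def]
  refine integral_congr_ae (ae_of_all _ fun t ↦ ?_)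
  simp [Circle.smul_def, mul_comm]

end Mollification

section Euclidean

variable {n : ℕ}

lemma enorm_clm_le_sum (A : EuclideanSpace ℝ (Fin n) →L[ℝ] ℝ) :
    ‖A‖ₑ ≤ ∑ k, ‖A (EuclideanSpace.single k 1)‖ₑ := by
  have h : ‖A‖ ≤ ∑ k, ‖A (EuclideanSpace.single k 1)‖ := by
    refine A.opNorm_le_bound (Finset.sum_nonneg fun _ _ ↦ norm_nonneg _) fun x ↦ ?_
    have hx : A x = ∑ k, x k * A (EuclideanSpace.single k 1) := by
      conv_lhs => rw [← (EuclideanSpace.basisFun (Fin n) ℝ).sum_repr x]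
      simp
    rw [hx, Finset.sum_mul]
    refine (norm_sum_le _ _).trans (Finset.sum_le_sum fun k _ ↦ ?_)
    rw [norm_mul, mul_comm]
    exact mul_le_mul_of_nonneg_left (PiLp.norm_apply_le x k) (norm_nonneg _)
  rw [← ofReal_norm]
  refine (ENNReal.ofReal_le_ofReal h).trans ?_
  rw [ENNReal.ofReal_sum_of_nonneg fun _ _ ↦ norm_nonneg _]
  simp only [ofReal_norm, le_refl]

/-- Mollification turns a weak partial derivative into a classical one. -/
lemma IsWeakDerivE.fderiv_convolution_apply {k : Fin n} {f g : EuclideanSpace ℝ (Fin n) → ℝ}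
    (h : IsWeakDerivE k f g) (hf : LocallyIntegrable f) {φ : EuclideanSpace ℝ (Fin n) → ℝ}
    (hφ : ContDiff ℝ (⊤ : ℕ∞) φ) (hφc : HasCompactSupport φ) (x : EuclideanSpace ℝ (Fin n)) :
    fderiv ℝ (convolution f φ (ContinuousLinearMap.mul ℝ ℝ) volume) x (EuclideanSpace.single k 1)
      = convolution g φ (ContinuousLinearMap.mul ℝ ℝ) volume x := by
  have hφ1 : ContDiff ℝ 1 φ := hφ.of_le (by exact_mod_cast le_top)
  rw [(hφc.hasFDerivAt_convolution_right (ContinuousLinearMap.mul ℝ ℝ) hf hφ1 x).fderiv,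
    convolution_precompR_apply _ hf (hφc.fderiv ℝ) (hφ1.continuous_fderiv one_ne_zero)]
  have hΦ := h (fun y ↦ φ (x - y)) (hφ.comp (contDiff_const.sub contDiff_id))
    (hφc.comp_homeomorph (Homeomorph.subLeft x))
  have hd : ∀ y, deriv (fun s : ℝ ↦ φ (x - (y + s • EuclideanSpace.single k (1 : ℝ)))) 0
      = -fderiv ℝ φ (x - y) (EuclideanSpace.single k 1) := by
    intro y
    have h1 : HasDerivAt (fun s : ℝ ↦ x - (y + s • EuclideanSpace.single k (1 : ℝ)))
        (-EuclideanSpace.single k (1 : ℝ)) 0 := by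
      simpa using (((hasDerivAt_id (0 : ℝ)).smul_const
        (EuclideanSpace.single k (1 : ℝ))).const_add y).const_sub x
    have h2 : HasFDerivAt φ (fderiv ℝ φ (x - y))
        (x - (y + (0 : ℝ) • EuclideanSpace.single k (1 : ℝ))) := by
      simpa using (hφ1.differentiable one_ne_zero (x - y)).hasFDerivAt
    rw [← map_neg]
    exact (h2.comp_hasDerivAt (0 : ℝ) h1).deriv
  simp only [hd, mul_neg, integral_neg, neg_inj] at hΦ
  simpa only [convolution_def, ContinuousLinearMap.mul_apply'] using hΦ

/-- The dyadic estimate for functions with integrable weak derivatives. -/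
lemma exists_tsum_dyadicSphereSup_le_of_isWeakDerivE (hn : 3 ≤ n) :
    ∃ C > 0, ∀ (f : EuclideanSpace ℝ (Fin n) → ℝ) (D : Fin n → EuclideanSpace ℝ (Fin n) → ℝ),
      Integrable f → (∀ j, Integrable (D j)) → (∀ j, IsWeakDerivE j f (D j)) →
      ∑' k, dyadicSphereSup (fun x ↦ (f x : ℂ)) k
        ≤ ENNReal.ofReal C * ∑ j, eLpNorm (D j) 1 volume := by
  obtain ⟨C, hC, hmain⟩ := exists_tsum_dyadicSphereSup_le_of_integrable
    (V := EuclideanSpace ℝ (Fin n)) (by simpa using hn)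
  refine ⟨C, hC, fun f D hf hD hw ↦ ?_⟩
  let φ : ℕ → ContDiffBump (0 : EuclideanSpace ℝ (Fin n)) := fun j ↦
    ⟨1 / ((j : ℝ) + 1) / 2, 1 / ((j : ℝ) + 1), by positivity, half_lt_self (by positivity)⟩
  have hφ : Filter.Tendsto (fun j ↦ (φ j).rOut) Filter.atTop (nhds 0) :=
    tendsto_one_div_add_atTop_nhds_zero_nat
  set H : ℕ → EuclideanSpace ℝ (Fin n) → ℝ := fun j ↦
    convolution f ((φ j).normed volume) (ContinuousLinearMap.mul ℝ ℝ) volume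
  have hHi : ∀ j, Integrable (H j) := fun j ↦
    hf.integrable_convolution _ (φ j).integrable_normed
  have hHc : ∀ j, ContDiff ℝ 1 (H j) := fun j ↦
    (φ j).hasCompactSupport_normed.contDiff_convolution_right (n := 1) _ hf.locallyIntegrable
      (φ j).contDiff_normed
  refine tsum_dyadicSphereSup_le_of_tendsto (G := fun j x ↦ (H j x : ℂ))
    (fun j ↦ (hHi j).ofReal) (fun ξ ↦ ?_) (fun j ↦ (hmain (H j) (hHc j) (hHi j)).trans ?_)
    tendsto_const_nhds
  · simp only [H, fourier_convolution_normed hf]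
    simpa using (tendsto_fourier_normed hφ ξ).const_mul (𝓕 (fun x ↦ (f x : ℂ)) ξ)
  · refine mul_le_mul_right ?_ _
    have hHd : ∀ x k, fderiv ℝ (H j) x (EuclideanSpace.single k 1)
        = convolution (D k) ((φ j).normed volume) (ContinuousLinearMap.mul ℝ ℝ) volume x :=
      fun x k ↦ (hw k).fderiv_convolution_apply hf.locallyIntegrable (φ j).contDiff_normed
        (φ j).hasCompactSupport_normed x
    calc ∫⁻ x, ‖fderiv ℝ (H j) x‖ₑ
        ≤ ∫⁻ x, ∑ k, ‖convolution (D k) ((φ j).normed volume)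
            (ContinuousLinearMap.mul ℝ ℝ) volume x‖ₑ := by
          refine lintegral_mono fun x ↦ (enorm_clm_le_sum _).trans_eq ?_
          simp only [hHd]
      _ = ∑ k, ∫⁻ x, ‖convolution (D k) ((φ j).normed volume)
            (ContinuousLinearMap.mul ℝ ℝ) volume x‖ₑ :=
          lintegral_finsetSum' _ fun k _ ↦
            ((hD k).integrable_convolution _ (φ j).integrable_normed).1.enorm
      _ ≤ ∑ k, eLpNorm (D k) 1 volume := by
          refine Finset.sum_le_sum fun k _ ↦ ?_
          rw [eLpNorm_one_eq_lintegral_enorm]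
          exact lintegral_enorm_convolution_normed_le (hD k) (φ j)

lemma dyadic_weight_le (hn : 3 ≤ n) (k : ℤ) {r : ℝ}
    (hr : r ∈ Icc ((2 : ℝ) ^ k) ((2 : ℝ) ^ (k + 1))) :
    (2 : ℝ≥0∞) ^ (((k * (2 - (n : ℤ))) : ℤ) : ℝ) * ENNReal.ofReal (r ^ (n - 1))
      ≤ ENNReal.ofReal (2 ^ (n - 2)) * ENNReal.ofReal r := by
  obtain ⟨m, rfl⟩ : ∃ m, n = m + 2 := ⟨n - 2, by omega⟩
  have h2k : (0 : ℝ) < 2 ^ k := by positivity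
  have hr0 : 0 < r := h2k.trans_le hr.1
  have h1 : (2 : ℝ≥0∞) ^ (((k * (2 - ((m + 2 : ℕ) : ℤ))) : ℤ) : ℝ)
      = ENNReal.ofReal (((2 : ℝ) ^ k)⁻¹ ^ m) := by
    rw [← ENNReal.ofReal_ofNat 2, ENNReal.ofReal_rpow_of_pos two_pos, Real.rpow_intCast]
    congr 1
    rw [← zpow_neg, ← zpow_natCast, ← zpow_mul]
    congr 1
    push_cast
    ring
  rw [h1, ← ENNReal.ofReal_mul (by positivity), ← ENNReal.ofReal_mul (by positivity)]
  refine ENNReal.ofReal_le_ofReal ?_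
  have h2 : (2 ^ k)⁻¹ * r ≤ 2 := by
    rw [inv_mul_le_iff₀ h2k, ← zpow_add_one₀ two_ne_zero]
    exact hr.2
  calc ((2 : ℝ) ^ k)⁻¹ ^ m * r ^ (m + 2 - 1) = ((2 ^ k)⁻¹ * r) ^ m * r := by
        rw [show m + 2 - 1 = m + 1 by omega, mul_pow, pow_succ, mul_assoc]
    _ ≤ 2 ^ (m + 2 - 2) * r := by
        rw [Nat.add_sub_cancel]
        gcongr

lemma dyadic_mul_iSup_sphereFourierInt_le (hn : 3 ≤ n) {f : EuclideanSpace ℝ (Fin n) → ℝ}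
    (hf : Integrable f) (k : ℤ) :
    (2 : ℝ≥0∞) ^ (((k * (2 - (n : ℤ))) : ℤ) : ℝ) *
        ⨆ (r : ℝ) (_ : r ∈ Icc ((2 : ℝ) ^ k) ((2 : ℝ) ^ (k + 1))), sphereFourierInt n f r
      ≤ ENNReal.ofReal (2 ^ (n - 2)) * dyadicSphereSup (fun x ↦ (f x : ℂ)) k := by
  simp only [ENNReal.mul_iSup]
  refine iSup₂_le fun r hr ↦ ?_
  have hc := continuous_fourierWith (μ := volume) (hf.ofReal (𝕜 := ℂ))
  rw [fourierWith_volume] at hc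
  have hs : sphereFourierInt n f r = ENNReal.ofReal (r ^ (n - 1)) *
      ∫⁻ θ, ‖𝓕 (fun x ↦ (f x : ℂ)) (r • θ)‖ₑ ∂(sphereMeasure (EuclideanSpace ℝ (Fin n))) := by
    rw [sphereMeasure, lintegral_map (f := fun θ ↦ ‖𝓕 (fun x ↦ (f x : ℂ)) (r • θ)‖ₑ)
      (continuous_enorm.comp (hc.comp (continuous_const_smul r))).measurable
      measurable_subtype_coe]
    rfl
  rw [hs, ← mul_assoc]
  refine (mul_le_mul_left (dyadic_weight_le hn k hr) _).trans ?_
  rw [mul_assoc]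
  refine mul_le_mul_right ?_ _
  exact le_iSup₂_of_le (f := fun (r : ℝ) (_ : r ∈ Icc ((2 : ℝ) ^ k) ((2 : ℝ) ^ (k + 1))) ↦
    ENNReal.ofReal r * ∫⁻ θ, ‖𝓕 (fun x ↦ (f x : ℂ)) (r • θ)‖ₑ
      ∂(sphereMeasure (EuclideanSpace ℝ (Fin n)))) r hr le_rfl

end Euclidean

/-- Theorem 1.5 / 6.5 (Oberlin type estimate): for f ∈ W¹₁(ℝⁿ), n ≥ 3,
Σ_{k∈ℤ} 2^{k(2−n)} sup_{2^k ≤ r ≤ 2^{k+1}} ∫_{S_r} |f̂(ξ)| dσ(ξ) ≤ c ‖∇f‖₁. -/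
theorem oberlin_type_estimate (n : ℕ) (hn : 3 ≤ n) :
    ∃ c > 0, ∀ (f : EuclideanSpace ℝ (Fin n) → ℝ)
      (D : Fin n → EuclideanSpace ℝ (Fin n) → ℝ),
      Integrable f volume → (∀ j, Integrable (D j) volume) →
      (∀ j, IsWeakDerivE j f (D j)) →
      ∑' k : ℤ, (2 : ℝ≥0∞) ^ (((k * (2 - (n:ℤ))) : ℤ) : ℝ) *
          ⨆ (r : ℝ) (_ : r ∈ Set.Icc ((2:ℝ)^k) ((2:ℝ)^(k+1))), sphereFourierInt n f r
        ≤ ENNReal.ofReal c * ∑ j : Fin n, eLpNorm (D j) 1 volume := by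
  obtain ⟨C, hC, hmain⟩ := exists_tsum_dyadicSphereSup_le_of_isWeakDerivE hn
  refine ⟨2 ^ (n - 2) * C, by positivity, fun f D hf hD hw ↦ ?_⟩
  refine (ENNReal.tsum_le_tsum fun k ↦ dyadic_mul_iSup_sphereFourierInt_le hn hf k).trans ?_
  rw [ENNReal.tsum_mul_left, ENNReal.ofReal_mul (by positivity), mul_assoc]
  exact mul_le_mul_right (hmain f D hf hD hw) _
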